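/- Fix a pattern σ ∈ S_k, μ ∈ ℳ and θ ∈ ℝ, and let ℱ(σ,μ,θ) be the (nonempty) set of maximizers of sup_{ν∈ℳ}{θ t_σ(ν) − D(ν|μ)}. Then the Lévy–Prokhorov distance from Em(π_{n,σ,μ,θ}) to the set 𝒪(ℱ(σ,μ,θ)) := {𝒪(ν) : ν ∈ ℱ(σ,μ,θ)} converges to 0 in probability as n → ∞. -/

import Mathlib

open MeasureTheory Filter Topology
open scoped ENNReal

noncomputable section

/-- The plane `ℝ²`, carrier for measures on the unit square. -/
abbrev Ω2 : Type := ℝ × ℝ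

/-- The unit square `[0,1]² ⊆ ℝ²`. -/
def unitSq : Set Ω2 := Set.Icc (0 : ℝ) 1 ×ˢ Set.Icc (0 : ℝ) 1

/-- Lebesgue measure on the unit square. -/
def lebSq : Measure Ω2 := volume.restrict unitSq

/-- `𝒫`: Borel probability measures concentrated on the unit square. -/
def Pcal : Set (ProbabilityMeasure Ω2) := {μ | (μ : Measure Ω2) unitSq = 1}

/-- `ℳ`: members of `𝒫` whose two coordinate marginals are atomless
(equivalently, have continuous CDFs). -/
def Mcal : Set (ProbabilityMeasure Ω2) :=
  {μ | μ ∈ Pcal ∧ (∀ x : ℝ, (μ : Measure Ω2).map Prod.fst {x} = 0) ∧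
      ∀ y : ℝ, (μ : Measure Ω2).map Prod.snd {y} = 0}

/-- The uniform distribution on `[0,1]`. -/
def unif01 : Measure ℝ := volume.restrict (Set.Icc (0 : ℝ) 1)

/-- `ℳ̃`: permutons, i.e. members of `𝒫` with both marginals uniform on `[0,1]`. -/
def Mtilde : Set (ProbabilityMeasure Ω2) :=
  {μ | μ ∈ Pcal ∧ (μ : Measure Ω2).map Prod.fst = unif01 ∧
      (μ : Measure Ω2).map Prod.snd = unif01}

open scoped Classical in
/-- `h_σ`: indicator that the `k` points induce the pattern `σ`. -/
def hPat {k : ℕ} (σ : Equiv.Perm (Fin k)) (z : Fin k → Ω2) : ℝ :=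
  if ∃ τ : Equiv.Perm (Fin k),
      StrictMono (fun i => (z (τ i)).1) ∧ StrictMono (fun i => (z (τ (σ⁻¹ i))).2)
  then 1 else 0

/-- Pattern density `t_σ(ν) = ∫ h_σ dν^{⊗k}`. -/
def tPat {k : ℕ} (σ : Equiv.Perm (Fin k)) (ν : Measure Ω2) : ℝ :=
  ∫ z, hPat σ z ∂(Measure.pi fun _ : Fin k => ν)

open scoped Classical in
/-- The permutation induced by `n` labelled points of `ℝ²` (junk value `1` if the
coordinates are not in generic position). -/
def inducedPerm {n : ℕ} (z : Fin n → Ω2) : Equiv.Perm (Fin n) :=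
  if h : ∃ σ : Equiv.Perm (Fin n), hPat σ z = 1 then h.choose else 1

/-- Empirical measure `Em(π) = (1/n) ∑ δ_{(i/n, π(i)/n)}` of a permutation, as a measure. -/
def EmM {n : ℕ} (π : Equiv.Perm (Fin n)) : Measure Ω2 :=
  (n : ℝ≥0∞)⁻¹ • ∑ i : Fin n, Measure.dirac ((((i : ℕ) + 1 : ℝ)) / n, (((π i : ℕ) + 1 : ℝ)) / n)

open scoped Classical in
/-- Empirical measure of a permutation as a probability measure (junk value for `n = 0`). -/
def EmP {n : ℕ} (π : Equiv.Perm (Fin n)) : ProbabilityMeasure Ω2 :=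
  if h : IsProbabilityMeasure (EmM π) then ⟨EmM π, h⟩
  else ⟨Measure.dirac 0, by infer_instance⟩

/-- `t_σ(π) := t_σ(Em(π))`. -/
def tPerm {k n : ℕ} (σ : Equiv.Perm (Fin k)) (π : Equiv.Perm (Fin n)) : ℝ := tPat σ (EmM π)

open scoped Classical in
/-- Kullback–Leibler divergence `D(ν|μ) ∈ [0,∞]`; for probability measures with `ν ≪ μ`
it equals `∫ log(dν/dμ) dν`, written here through the nonnegative integrand
`g log g + 1 - g` of the density `g = dν/dμ` (the correction `∫ (1-g) dμ = 0`). -/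
def KL (ν μ : Measure Ω2) : ℝ≥0∞ :=
  if ν ≪ μ then
    ∫⁻ z, ENNReal.ofReal ((ν.rnDeriv μ z).toReal * Real.log ((ν.rnDeriv μ z).toReal)
      + 1 - (ν.rnDeriv μ z).toReal) ∂μ
  else ∞

/-- CDF of the first marginal. -/
def cdfX (μ : Measure Ω2) (x : ℝ) : ℝ := (μ {p : Ω2 | p.1 ≤ x}).toReal

/-- CDF of the second marginal. -/
def cdfY (μ : Measure Ω2) (y : ℝ) : ℝ := (μ {p : Ω2 | p.2 ≤ y}).toReal

/-- The map `𝒪`: pushforward of `μ` under `(x,y) ↦ (F₁(x), F₂(y))`. -/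
def Omap (μ : Measure Ω2) : Measure Ω2 := μ.map fun p => (cdfX μ p.1, cdfY μ p.2)

/-- The product measure `μ^{⊗n}` governing `n` i.i.d. samples. -/
def pmeas (μ : Measure Ω2) (n : ℕ) : Measure (Fin n → Ω2) := Measure.pi fun _ => μ

/-- Log-partition function `F_n(σ,μ,θ) = log E[exp(nθ t_σ(π_{n,μ}))]`. -/
def Fn {k : ℕ} (σ : Equiv.Perm (Fin k)) (μ : Measure Ω2) (θ : ℝ) (n : ℕ) : ℝ :=
  Real.log (∫ z, Real.exp (n * θ * tPerm σ (inducedPerm z)) ∂pmeas μ n)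

/-- The Gibbs measure `Q_{n,σ,μ,θ}` on `([0,1]²)ⁿ`. -/
def Qgibbs {k : ℕ} (σ : Equiv.Perm (Fin k)) (μ : Measure Ω2) (θ : ℝ) (n : ℕ) :
    Measure (Fin n → Ω2) :=
  (pmeas μ n).withDensity fun z =>
    ENNReal.ofReal (Real.exp (n * θ * tPerm σ (inducedPerm z) - Fn σ μ θ n))

/-- `F(σ,μ,θ) = sup_{ν ∈ ℳ} { θ t_σ(ν) − D(ν|μ) }`, valued in `EReal`. -/
def Fsup {k : ℕ} (σ : Equiv.Perm (Fin k)) (μ : Measure Ω2) (θ : ℝ) : EReal :=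
  ⨆ ν ∈ Mcal, (((θ * tPat σ (ν : Measure Ω2) : ℝ) : EReal) - ((KL (↑ν) μ : ℝ≥0∞) : EReal))

/-- `ℱ(σ,μ,θ)`: the set of maximizers of `ν ↦ θ t_σ(ν) − D(ν|μ)` over `ℳ`. -/
def Fset {k : ℕ} (σ : Equiv.Perm (Fin k)) (μ : Measure Ω2) (θ : ℝ) :
    Set (ProbabilityMeasure Ω2) :=
  {ν | ν ∈ Mcal ∧
    (((θ * tPat σ (ν : Measure Ω2) : ℝ) : EReal) - ((KL (↑ν) μ : ℝ≥0∞) : EReal)) = Fsup σ μ θ}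

/-- `G(σ,μ,δ) = inf { D(ν|μ) : ν ∈ ℳ, t_σ(ν) ≥ δ }`. -/
def Gfun {k : ℕ} (σ : Equiv.Perm (Fin k)) (μ : Measure Ω2) (δ : ℝ) : ℝ≥0∞ :=
  ⨅ ν ∈ {ν : ProbabilityMeasure Ω2 | ν ∈ Mcal ∧ δ ≤ tPat σ (ν : Measure Ω2)}, KL (↑ν) μ

/-- `𝒢(σ,μ,δ)`: the set of minimizers in the definition of `G(σ,μ,δ)`. -/
def Gset {k : ℕ} (σ : Equiv.Perm (Fin k)) (μ : Measure Ω2) (δ : ℝ) :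
    Set (ProbabilityMeasure Ω2) :=
  {ν | (ν ∈ Mcal ∧ δ ≤ tPat σ (ν : Measure Ω2)) ∧ KL (↑ν) μ = Gfun σ μ δ}

/-- `α_σ(μ) = inf {δ : G(σ,μ,δ) = ∞}`. -/
def alphaSig {k : ℕ} (σ : Equiv.Perm (Fin k)) (μ : Measure Ω2) : ℝ :=
  sInf {δ : ℝ | Gfun σ μ δ = ∞}

/-- `μ` is conditionally constant (CC) with respect to a pattern `σ` of size `k+1`:
the conditional probability `P(π_{X,Y} = σ | (X₁,Y₁))`, which for i.i.d. samples equals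
`z ↦ ∫ h_σ(z, w) dμ^{⊗k}(w)`, is `μ`-a.s. equal to a constant `c ∈ [0,1]`. -/
def IsCC {k : ℕ} (σ : Equiv.Perm (Fin (k + 1))) (μ : Measure Ω2) : Prop :=
  ∃ c ∈ Set.Icc (0 : ℝ) 1, ∀ᵐ z ∂μ,
    (∫ w : Fin k → Ω2, hPat σ (Fin.cons z w) ∂pmeas μ k) = c

/-- The inversion pattern `21 ∈ S₂`. -/
def inv2 : Equiv.Perm (Fin 2) := Equiv.swap 0 1

/-- Lévy–Prokhorov (extended) distance between measures on `ℝ²`. -/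
def dLPE (μ ν : Measure Ω2) : ℝ≥0∞ := levyProkhorovEDist μ ν

/-- The topological support of a measure: the points whose every open neighbourhood
has positive measure. -/
def msupport (μ : Measure Ω2) : Set Ω2 :=
  {z | ∀ U : Set Ω2, IsOpen U → z ∈ U → 0 < μ U}


/-- The configurations of `k` points inducing the pattern `σ`. -/
def patSet {k : ℕ} (σ : Equiv.Perm (Fin k)) : Set (Fin k → Ω2) :=
  {z | ∃ τ : Equiv.Perm (Fin k),
      StrictMono (fun i => (z (τ i)).1) ∧ StrictMono (fun i => (z (τ (σ⁻¹ i))).2)}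

/-- Configurations without ties in either coordinate. -/
def IsGeneric {n : ℕ} (z : Fin n → Ω2) : Prop :=
  Function.Injective (fun i => (z i).1) ∧ Function.Injective (fun i => (z i).2)

lemma hPat_eq_indicator {k : ℕ} (σ : Equiv.Perm (Fin k)) :
    hPat σ = (patSet σ).indicator 1 := by
  ext z
  simp [hPat, patSet, Set.indicator_apply]

lemma hPat_eq_one_iff {k : ℕ} (σ : Equiv.Perm (Fin k)) (z : Fin k → Ω2) :
    hPat σ z = 1 ↔ z ∈ patSet σ := by
  rw [hPat_eq_indicator]
  by_cases h : z ∈ patSet σ <;> simp [h]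

lemma isOpen_strictMono_comp {k : ℕ} {f : (Fin k → Ω2) → Fin k → ℝ}
    (hf : ∀ i, Continuous fun z => f z i) : IsOpen {z | StrictMono (f z)} := by
  simp only [StrictMono, Set.ofPred_forall]
  exact isOpen_iInter_of_finite fun i => isOpen_iInter_of_finite fun j =>
    isOpen_iInter_of_finite fun _ => isOpen_lt (hf i) (hf j)

lemma isClosed_monotone_comp {k : ℕ} {f : (Fin k → Ω2) → Fin k → ℝ}
    (hf : ∀ i, Continuous fun z => f z i) : IsClosed {z | Monotone (f z)} := by
  simp only [Monotone, Set.ofPred_forall]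
  exact isClosed_iInter fun i => isClosed_iInter fun j =>
    isClosed_iInter fun _ => isClosed_le (hf i) (hf j)

lemma isOpen_patSet {k : ℕ} (σ : Equiv.Perm (Fin k)) : IsOpen (patSet σ) := by
  simp only [patSet, Set.ofPred_exists]
  refine isOpen_iUnion fun τ => ?_
  exact (isOpen_strictMono_comp fun i => by fun_prop).inter
    (isOpen_strictMono_comp fun i => by fun_prop)

lemma measurable_hPat {k : ℕ} (σ : Equiv.Perm (Fin k)) : Measurable (hPat σ) := by
  rw [hPat_eq_indicator]
  exact measurable_one.indicator (isOpen_patSet σ).measurableSet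

lemma tPat_eq_measureReal {k : ℕ} (σ : Equiv.Perm (Fin k)) (ν : Measure Ω2) :
    tPat σ ν = (Measure.pi fun _ : Fin k => ν).real (patSet σ) := by
  rw [tPat, hPat_eq_indicator, integral_indicator_one (isOpen_patSet σ).measurableSet]

lemma frontier_patSet_subset {k : ℕ} (σ : Equiv.Perm (Fin k)) :
    frontier (patSet σ) ⊆ {z | ¬ IsGeneric z} := by
  have hcl : IsClosed {z : Fin k → Ω2 | ∃ τ : Equiv.Perm (Fin k),
      Monotone (fun i => (z (τ i)).1) ∧ Monotone (fun i => (z (τ (σ⁻¹ i))).2)} := by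
    simp only [Set.ofPred_exists]
    refine isClosed_iUnion_of_finite fun τ => ?_
    exact (isClosed_monotone_comp fun i => by fun_prop).inter
      (isClosed_monotone_comp fun i => by fun_prop)
  rw [(isOpen_patSet σ).frontier_eq]
  rintro z ⟨hz, hz'⟩ ⟨h1, h2⟩
  obtain ⟨τ, hτ1, hτ2⟩ := hcl.closure_subset_iff.2
    (fun z hz => hz.imp fun τ h => ⟨h.1.monotone, h.2.monotone⟩) hz
  exact hz' ⟨τ, hτ1.strictMono_of_injective (h1.comp τ.injective),
    hτ2.strictMono_of_injective (h2.comp (τ.injective.comp σ⁻¹.injective))⟩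

lemma iIndepFun_coord {n : ℕ} (ν : Measure Ω2) [IsProbabilityMeasure ν] :
    ProbabilityTheory.iIndepFun (fun (i : Fin n) (z : Fin n → Ω2) => z i)
      (Measure.pi fun _ : Fin n => ν) :=
  ProbabilityTheory.iIndepFun_pi (μ := fun _ : Fin n => ν) (X := fun _ => id)
    fun _ => aemeasurable_id

lemma pi_map_comp_injective {k n : ℕ} (ν : Measure Ω2) [IsProbabilityMeasure ν]
    {s : Fin k → Fin n} (hs : Function.Injective s) :
    (Measure.pi fun _ : Fin n => ν).map (fun z => z ∘ s) = Measure.pi fun _ : Fin k => ν := by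
  have h := ((iIndepFun_coord (n := n) ν).precomp hs).map_fun_eq_pi_map
    (fun i => (measurable_pi_apply (s i)).aemeasurable)
  simp only [(measurePreserving_eval (fun _ : Fin n => ν) _).map_eq] at h
  exact h

lemma pi_tie_null {n : ℕ} (ν : Measure Ω2) [IsProbabilityMeasure ν] {p : Ω2 → ℝ}
    (hp : Measurable p) (h : ∀ x, ν.map p {x} = 0) {i j : Fin n} (hij : i ≠ j) :
    ∀ᵐ z ∂(Measure.pi fun _ : Fin n => ν), p (z i) ≠ p (z j) := by
  have hi : ∀ i : Fin n, (Measure.pi fun _ : Fin n => ν).map (fun z => p (z i)) = ν.map p := by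
    intro i
    have h := congrArg (Measure.map p) (measurePreserving_eval (fun _ : Fin n => ν) i).map_eq
    rwa [Measure.map_map hp (measurable_pi_apply i)] at h
  have hind := ((iIndepFun_coord (n := n) ν).indepFun hij).comp hp hp
  have hmap := hind.map_prod_eq_prod_map_map (hp.comp (measurable_pi_apply i)).aemeasurable
    (hp.comp (measurable_pi_apply j)).aemeasurable
  have hdiag : MeasurableSet {q : ℝ × ℝ | q.1 = q.2} :=
    measurableSet_eq_fun measurable_fst measurable_snd
  have hnull : ((ν.map p).prod (ν.map p)) {q : ℝ × ℝ | q.1 = q.2} = 0 := by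
    have : IsProbabilityMeasure (ν.map p) := Measure.isProbabilityMeasure_map hp.aemeasurable
    rw [Measure.measure_prod_null hdiag]
    refine Eventually.of_forall fun x => ?_
    have : Prod.mk x ⁻¹' {q : ℝ × ℝ | q.1 = q.2} = {x} := by ext y; simp [eq_comm]
    simp [this, h]
  have hcomp : ∀ i : Fin n, (p ∘ fun z : Fin n → Ω2 => z i) = fun z => p (z i) := fun _ => rfl
  rw [hcomp, hcomp, hi, hi] at hmap
  rw [← hmap, Measure.map_apply (by fun_prop) hdiag] at hnull
  rw [ae_iff]
  simpa using hnull

lemma ae_isGeneric {n : ℕ} {ν : ProbabilityMeasure Ω2} (hν : ν ∈ Mcal) :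
    ∀ᵐ z ∂(Measure.pi fun _ : Fin n => (ν : Measure Ω2)), IsGeneric z := by
  have key : ∀ p : Ω2 → ℝ, Measurable p → (∀ x, (ν : Measure Ω2).map p {x} = 0) →
      ∀ᵐ z ∂(Measure.pi fun _ : Fin n => (ν : Measure Ω2)),
        Function.Injective fun i => p (z i) := by
    intro p hp h
    have : ∀ i j : Fin n, ∀ᵐ z ∂(Measure.pi fun _ : Fin n => (ν : Measure Ω2)),
        i ≠ j → p (z i) ≠ p (z j) := fun i j => by
      by_cases hij : i = j
      · simp [hij]
      · exact (pi_tie_null _ hp h hij).mono fun z hz _ => hz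
    filter_upwards [ae_all_iff.2 fun i => ae_all_iff.2 (this i)] with z hz i j hij
    by_contra hne
    exact hz i j hne hij
  filter_upwards [key _ measurable_fst hν.2.1, key _ measurable_snd hν.2.2] with z h1 h2
  exact ⟨h1, h2⟩

lemma exists_hPat_eq_one {n : ℕ} {z : Fin n → Ω2} (hz : IsGeneric z) :
    ∃ σ : Equiv.Perm (Fin n), hPat σ z = 1 := by
  set a := Tuple.sort fun i => (z i).1
  set b := Tuple.sort fun i => (z i).2
  have ha : Monotone fun i => (z (a i)).1 := Tuple.monotone_sort fun i => (z i).1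
  have hb : Monotone fun i => (z (b i)).2 := Tuple.monotone_sort fun i => (z i).2
  refine ⟨b⁻¹ * a, (hPat_eq_one_iff _ _).2 ⟨a,
    ha.strictMono_of_injective (hz.1.comp a.injective), ?_⟩⟩
  simpa using hb.strictMono_of_injective (hz.2.comp b.injective)

lemma inducedPerm_mem_patSet {n : ℕ} {z : Fin n → Ω2} (hz : IsGeneric z) :
    z ∈ patSet (inducedPerm z) := by
  have h := exists_hPat_eq_one hz
  rw [← hPat_eq_one_iff, inducedPerm, dif_pos h]
  exact h.choose_spec

/-- The empirical measure of a finite configuration. -/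
def empM {n : ℕ} (z : Fin n → Ω2) : Measure Ω2 := (n : ℝ≥0∞)⁻¹ • ∑ i, Measure.dirac (z i)

/-- The pattern density of a finite configuration, ties included. -/
def tEmp {k n : ℕ} (σ : Equiv.Perm (Fin k)) (z : Fin n → Ω2) : ℝ :=
  ((n : ℝ) ^ k)⁻¹ * ∑ s : Fin k → Fin n, hPat σ (z ∘ s)

instance {n : ℕ} [NeZero n] (z : Fin n → Ω2) : IsProbabilityMeasure (empM z) := by
  constructor
  simp only [empM, Measure.smul_apply, Measure.finsetSum_apply, measure_univ, Finset.sum_const,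
    Finset.card_univ, Fintype.card_fin, nsmul_eq_mul, mul_one, smul_eq_mul]
  exact ENNReal.inv_mul_cancel (by simp [NeZero.ne n]) (by simp)

lemma pi_empM {k n : ℕ} [NeZero n] (z : Fin n → Ω2) :
    (Measure.pi fun _ : Fin k => empM z)
      = ((n : ℝ≥0∞) ^ k)⁻¹ • ∑ s : Fin k → Fin n, Measure.dirac (z ∘ s) := by
  refine Measure.pi_eq fun A hA => ?_
  have h : ∀ s : Fin k → Fin n, Measure.dirac (z ∘ s) (Set.univ.pi A)
      = ∏ j, Measure.dirac (z (s j)) (A j) := by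
    intro s
    rw [Measure.dirac_apply' _ (MeasurableSet.univ_pi hA)]
    simp_rw [fun j => Measure.dirac_apply' (z (s j)) (hA j)]
    by_cases hs : z ∘ s ∈ Set.univ.pi A
    · rw [Set.indicator_of_mem hs, Finset.prod_eq_one]
      · rfl
      · intro j _
        exact Set.indicator_of_mem (hs j (Set.mem_univ j)) 1
    · rw [Set.indicator_of_notMem hs]
      simp only [Set.mem_univ_pi, not_forall] at hs
      obtain ⟨j, hj⟩ := hs
      exact (Finset.prod_eq_zero (Finset.mem_univ j) (Set.indicator_of_notMem hj 1)).symm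
  simp only [empM, Measure.smul_apply, Measure.finsetSum_apply, h, smul_eq_mul,
    Finset.prod_mul_distrib, Finset.prod_const, Finset.card_univ, Fintype.card_fin,
    ENNReal.inv_pow, Finset.prod_univ_sum, Fintype.piFinset_univ]

lemma tPat_empM {k n : ℕ} [NeZero n] (σ : Equiv.Perm (Fin k)) (z : Fin n → Ω2) :
    tPat σ (empM z) = tEmp σ z := by
  rw [tPat, pi_empM, integral_smul_measure, integral_finsetSum_measure]
  · simp [tEmp]
  · intro s _
    exact integrable_dirac (by simp)

lemma hPat_congr {k : ℕ} (σ : Equiv.Perm (Fin k)) {z w : Fin k → Ω2}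
    (h1 : ∀ i j, (z i).1 < (z j).1 ↔ (w i).1 < (w j).1)
    (h2 : ∀ i j, (z i).2 < (z j).2 ↔ (w i).2 < (w j).2) : hPat σ z = hPat σ w := by
  have : z ∈ patSet σ ↔ w ∈ patSet σ := by simp only [patSet, StrictMono, Set.mem_ofPred_eq, h1, h2]
  by_cases hz : z ∈ patSet σ
  · rw [(hPat_eq_one_iff σ z).2 hz, (hPat_eq_one_iff σ w).2 (this.1 hz)]
  · simp [hPat_eq_indicator, hz, mt this.2 hz]

lemma tPerm_inducedPerm {k n : ℕ} [NeZero n] (σ : Equiv.Perm (Fin k)) {z : Fin n → Ω2}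
    (hz : IsGeneric z) : tPerm σ (inducedPerm z) = tEmp σ z := by
  obtain ⟨τ, h1, h2⟩ := inducedPerm_mem_patSet hz
  set π := inducedPerm z
  have hn : (0 : ℝ) < n := Nat.cast_pos.2 (NeZero.pos n)
  set w : Fin n → Ω2 := fun i => ((((i : ℕ) + 1 : ℝ)) / n, (((π i : ℕ) + 1 : ℝ)) / n)
  have hw : tPerm σ π = tEmp σ w := tPat_empM σ w
  have hord1 : ∀ i j, (w i).1 < (w j).1 ↔ (z (τ i)).1 < (z (τ j)).1 := by
    intro i j
    rw [h1.lt_iff_lt]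
    simp [w, div_lt_div_iff_of_pos_right hn]
  have hord2 : ∀ i j, (w i).2 < (w j).2 ↔ (z (τ i)).2 < (z (τ j)).2 := by
    intro i j
    have := h2.lt_iff_lt (a := π i) (b := π j)
    simp only [Equiv.Perm.inv_def, Equiv.symm_apply_apply] at this
    rw [this]
    simp [w, div_lt_div_iff_of_pos_right hn]
  rw [hw, tEmp, tEmp]
  congr 1
  refine Fintype.sum_equiv (Equiv.arrowCongr (Equiv.refl _) τ) _ _ fun s => ?_
  exact hPat_congr σ (fun i j => hord1 (s i) (s j)) (fun i j => hord2 (s i) (s j))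

lemma cdf_empM_of_strictMono {n : ℕ} [NeZero n] {z : Fin n → Ω2} {p : Ω2 → ℝ}
    (hp : Measurable p) {τ : Equiv.Perm (Fin n)} (h : StrictMono fun i => p (z (τ i)))
    (i : Fin n) : (empM z {q | p q ≤ p (z (τ i))}).toReal = ((i : ℕ) + 1 : ℝ) / n := by
  have hs : MeasurableSet {q | p q ≤ p (z (τ i))} := hp measurableSet_Iic
  have hsum : ∑ j, (Measure.dirac (z j) {q | p q ≤ p (z (τ i))} : ℝ≥0∞) = ((i : ℕ) + 1 : ℕ) := by
    rw [← Equiv.sum_comp τ]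
    simp_rw [fun j => Measure.dirac_apply' (z (τ j)) hs, Set.indicator_apply, Set.mem_ofPred_eq,
      h.le_iff_le, Pi.one_apply]
    rw [Finset.sum_boole]
    congr 1
    have : ({j : Fin n | j ≤ i} : Finset (Fin n)) = Finset.Iic i := by ext; simp
    rw [this, Fin.card_Iic]
  simp only [empM, Measure.smul_apply, Measure.finsetSum_apply, hsum, smul_eq_mul]
  rw [ENNReal.toReal_mul, ENNReal.toReal_inv, ENNReal.toReal_natCast, ENNReal.toReal_natCast]
  push_cast
  rw [inv_mul_eq_div]

lemma measurable_cdfX (μ : Measure Ω2) [IsFiniteMeasure μ] : Measurable (cdfX μ) :=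
  Monotone.measurable fun _ _ h => ENNReal.toReal_mono (measure_ne_top _ _)
    (measure_mono fun _ hp => le_trans hp h)

lemma measurable_cdfY (μ : Measure Ω2) [IsFiniteMeasure μ] : Measurable (cdfY μ) :=
  Monotone.measurable fun _ _ h => ENNReal.toReal_mono (measure_ne_top _ _)
    (measure_mono fun _ hp => le_trans hp h)

lemma measurable_cdf_prod (μ : Measure Ω2) [IsFiniteMeasure μ] :
    Measurable fun p : Ω2 => (cdfX μ p.1, cdfY μ p.2) :=
  ((measurable_cdfX μ).comp measurable_fst).prodMk ((measurable_cdfY μ).comp measurable_snd)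

/-- In generic position, the empirical measure of the induced permutation is the image under `𝒪`
of the empirical measure of the configuration. -/
lemma EmM_inducedPerm {n : ℕ} [NeZero n] {z : Fin n → Ω2} (hz : IsGeneric z) :
    EmM (inducedPerm z) = Omap (empM z) := by
  obtain ⟨τ, h1, h2⟩ := inducedPerm_mem_patSet hz
  set π := inducedPerm z
  have hG := measurable_cdf_prod (empM z)
  have hmap : Omap (empM z)
      = (n : ℝ≥0∞)⁻¹ • ∑ i, Measure.dirac (cdfX (empM z) (z i).1, cdfY (empM z) (z i).2) := by
    rw [Omap]
    conv_lhs => enter [2]; rw [empM]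
    rw [Measure.map_smul, Measure.map_finset_sum hG.aemeasurable]
    simp_rw [Measure.map_dirac' hG]
  rw [hmap, EmM, ← Equiv.sum_comp τ fun i =>
    Measure.dirac (cdfX (empM z) (z i).1, cdfY (empM z) (z i).2)]
  congr 1
  refine Finset.sum_congr rfl fun i _ => ?_
  have hx : cdfX (empM z) (z (τ i)).1 = ((i : ℕ) + 1 : ℝ) / n :=
    cdf_empM_of_strictMono measurable_fst h1 i
  have hy : cdfY (empM z) (z (τ i)).2 = ((π i : ℕ) + 1 : ℝ) / n := by
    have := cdf_empM_of_strictMono (τ := (π⁻¹ : Equiv.Perm (Fin n)).trans τ) measurable_snd h2 (π i)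
    simpa [cdfY] using this
  rw [hx, hy]

lemma tPat_mem_Icc {k : ℕ} (σ : Equiv.Perm (Fin k)) (ν : Measure Ω2) [IsProbabilityMeasure ν] :
    tPat σ ν ∈ Set.Icc (0 : ℝ) 1 := by
  rw [tPat_eq_measureReal]
  exact ⟨measureReal_nonneg, measureReal_le_one⟩

/-- Pattern densities are weakly continuous at measures with atomless marginals. -/
lemma tendsto_tPat {k : ℕ} (σ : Equiv.Perm (Fin k)) {ν : ProbabilityMeasure Ω2} (hν : ν ∈ Mcal) :
    Tendsto (fun ν' : ProbabilityMeasure Ω2 => tPat σ (ν' : Measure Ω2)) (𝓝 ν)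
      (𝓝 (tPat σ (ν : Measure Ω2))) := by
  simp_rw [tPat_eq_measureReal]
  have hc : Continuous fun ν' : ProbabilityMeasure Ω2 =>
      ProbabilityMeasure.pi fun _ : Fin k => ν' :=
    ProbabilityMeasure.continuous_pi.comp (continuous_pi fun _ => continuous_id)
  have hnull : ((ProbabilityMeasure.pi fun _ : Fin k => ν : ProbabilityMeasure (Fin k → Ω2)) :
      Measure (Fin k → Ω2)) (frontier (patSet σ)) = 0 :=
    measure_mono_null (frontier_patSet_subset σ) (ae_isGeneric hν)
  have h := ProbabilityMeasure.tendsto_measure_of_null_frontier_of_tendsto' (hc.tendsto ν) hnull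
  exact (ENNReal.tendsto_toReal (measure_ne_top _ _)).comp h

lemma levyProkhorovEDist_map_le {α : Type*} [MeasurableSpace α] (ν : Measure α)
    {f g : α → Ω2} (hf : Measurable f) (hg : Measurable g) {δ : ℝ}
    (hδ : 0 ≤ δ) (h : ∀ p, dist (f p) (g p) ≤ δ) :
    levyProkhorovEDist (ν.map f) (ν.map g) ≤ ENNReal.ofReal δ := by
  refine levyProkhorovEDist_le_of_forall _ _ _ fun ε B hδε hε hB => ?_
  have hlt : δ < ε.toReal := (ENNReal.ofReal_lt_iff_lt_toReal hδ hε.ne).1 hδε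
  have key : ∀ {f g : α → Ω2}, Measurable f → Measurable g → (∀ p, dist (f p) (g p) ≤ δ) →
      ν.map f B ≤ ν.map g (Metric.thickening ε.toReal B) + ε := by
    intro f g hf hg h
    refine le_add_right ?_
    rw [Measure.map_apply hf hB, Measure.map_apply hg Metric.isOpen_thickening.measurableSet]
    refine measure_mono fun p hp => ?_
    exact Metric.mem_thickening_iff.2 ⟨f p, hp, by rw [dist_comm]; exact (h p).trans_lt hlt⟩
  exact ⟨key hf hg h, key hg hf fun p => by rw [dist_comm]; exact h p⟩

lemma cdf_map_apply (ν : Measure Ω2) [IsProbabilityMeasure ν] {p : Ω2 → ℝ} (hp : Measurable p)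
    (x : ℝ) : ProbabilityTheory.cdf (ν.map p) x = (ν {q | p q ≤ x}).toReal := by
  have := Measure.isProbabilityMeasure_map (μ := ν) hp.aemeasurable
  rw [ProbabilityTheory.cdf_eq_real, measureReal_def, Measure.map_apply hp measurableSet_Iic]
  rfl

lemma continuous_cdf {m : Measure ℝ} [IsProbabilityMeasure m] (hm : ∀ x, m {x} = 0) :
    Continuous (ProbabilityTheory.cdf m) := by
  refine continuous_iff_continuousAt.2 fun x => ?_
  rw [(ProbabilityTheory.cdf m).mono.continuousAt_iff_leftLim_eq_rightLim,
    StieltjesFunction.rightLim_eq]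
  refine le_antisymm ((ProbabilityTheory.cdf m).mono.leftLim_le le_rfl) ?_
  have h := (ProbabilityTheory.cdf m).measure_singleton x
  rw [ProbabilityTheory.measure_cdf, hm] at h
  linarith [ENNReal.ofReal_eq_zero.1 h.symm]

/-- Pólya's theorem: near a measure under which `p` has a continuous distribution function, the
distribution functions of `p` are uniformly close. -/
lemma eventually_cdf_close {ν : ProbabilityMeasure Ω2} {p : Ω2 → ℝ} (hp : Continuous p)
    (hν : ∀ x, (ν : Measure Ω2).map p {x} = 0) {ε : ℝ} (hε : 0 < ε) :
    ∀ᶠ ν' : ProbabilityMeasure Ω2 in 𝓝 ν,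
      ∀ x, |((ν' : Measure Ω2) {q | p q ≤ x}).toReal - ((ν : Measure Ω2) {q | p q ≤ x}).toReal|
        ≤ ε := by
  set F : ProbabilityMeasure Ω2 → ℝ → ℝ := fun ν' x => ((ν' : Measure Ω2) {q | p q ≤ x}).toReal
    with hF
  have hmono : ∀ ν', Monotone (F ν') := fun ν' x y hxy =>
    ENNReal.toReal_mono (measure_ne_top _ _) (measure_mono fun q hq => le_trans hq hxy)
  have h0 : ∀ ν' x, 0 ≤ F ν' x := fun ν' x => ENNReal.toReal_nonneg
  have h1 : ∀ ν' x, F ν' x ≤ 1 := fun ν' x => measureReal_le_one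
  have hm : IsProbabilityMeasure ((ν : Measure Ω2).map p) :=
    Measure.isProbabilityMeasure_map hp.measurable.aemeasurable
  have hcdf : ⇑(ProbabilityTheory.cdf ((ν : Measure Ω2).map p)) = F ν :=
    funext fun x => cdf_map_apply _ hp.measurable x
  have hcont : Continuous (F ν) := hcdf ▸ continuous_cdf hν
  have hbot : Tendsto (F ν) atBot (𝓝 0) := hcdf ▸ ProbabilityTheory.tendsto_cdf_atBot _
  have htop : Tendsto (F ν) atTop (𝓝 1) := hcdf ▸ ProbabilityTheory.tendsto_cdf_atTop _
  have hlim : ∀ x, Tendsto (fun ν' => F ν' x) (𝓝 ν) (𝓝 (F ν x)) := by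
    intro x
    have hnull : (ν : Measure Ω2) (frontier {q | p q ≤ x}) = 0 := by
      refine measure_mono_null (frontier_le_subset_eq hp continuous_const) ?_
      have := hν x
      rwa [Measure.map_apply hp.measurable (measurableSet_singleton x)] at this
    exact (ENNReal.tendsto_toReal (measure_ne_top _ _)).comp
      (ProbabilityMeasure.tendsto_measure_of_null_frontier_of_tendsto' tendsto_id hnull)
  obtain ⟨N, hN⟩ := exists_nat_gt (3 / ε)
  have hN0 : (0 : ℝ) < N := (by positivity : (0 : ℝ) < 3 / ε).trans hN
  have hNε : 3 / (N : ℝ) ≤ ε := by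
    rw [div_le_iff₀ hN0]
    rw [div_lt_iff₀ hε] at hN
    linarith
  have hquant : ∀ i : ℕ, ∃ t, 0 < i → i < N → F ν t = i / N := by
    intro i
    by_cases hi : 0 < i ∧ i < N
    · have hlo : (0 : ℝ) < i / N := div_pos (Nat.cast_pos.2 hi.1) hN0
      have hhi : (i : ℝ) / N < 1 := (div_lt_one hN0).2 (Nat.cast_lt.2 hi.2)
      obtain ⟨a, ha⟩ := (hbot.eventually (gt_mem_nhds hlo)).exists
      obtain ⟨b, hb⟩ := (htop.eventually (lt_mem_nhds hhi)).exists
      obtain ⟨t, ht⟩ := mem_range_of_exists_le_of_exists_ge hcont ⟨a, ha.le⟩ ⟨b, hb.le⟩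
      exact ⟨t, fun _ _ => ht⟩
    · exact ⟨0, fun h h' => absurd ⟨h, h'⟩ hi⟩
  choose t ht using hquant
  have hev : ∀ᶠ ν' in 𝓝 ν, ∀ i ∈ Finset.range N, |F ν' (t i) - F ν (t i)| < 1 / N := by
    rw [Filter.eventually_all_finset]
    intro i _
    have := Metric.tendsto_nhds.1 (hlim (t i)) (1 / N) (by positivity)
    simpa [Real.dist_eq] using this
  filter_upwards [hev] with ν' hν' x
  set i := ⌊F ν x * N⌋₊ with hi
  have hi1 : (i : ℝ) ≤ F ν x * N := Nat.floor_le (mul_nonneg (h0 _ _) hN0.le)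
  have hi2 : F ν x * N < i + 1 := Nat.lt_floor_add_one _
  have hi1' : (i : ℝ) / N ≤ F ν x := (div_le_iff₀ hN0).2 hi1
  have hi2' : F ν x < ((i : ℝ) + 1) / N := (lt_div_iff₀ hN0).2 hi2
  have hup : F ν' x ≤ F ν x + 3 / N := by
    by_cases hlt : i + 1 < N
    · have hq := ht (i + 1) (Nat.succ_pos _) hlt
      have hx : x ≤ t (i + 1) := by
        by_contra hx
        have := hmono ν (not_le.1 hx).le
        rw [hq] at this
        push_cast at this
        linarith
      have hc := (abs_lt.1 (hν' (i + 1) (Finset.mem_range.2 hlt))).2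
      have := hmono ν' hx
      rw [hq] at hc
      push_cast at hc
      have e1 : ((i : ℝ) + 1) / N = i / N + 1 / N := add_div _ _ _
      have e2 : (3 : ℝ) / N = 3 * (1 / N) := by ring
      have e3 : (0 : ℝ) < 1 / N := by positivity
      linarith
    · have : (N : ℝ) ≤ i + 1 := by exact_mod_cast not_lt.1 hlt
      have e0 : 1 ≤ ((i : ℝ) + 1) / N := (one_le_div hN0).2 this
      have e1 : ((i : ℝ) + 1) / N = i / N + 1 / N := add_div _ _ _
      have e2 : (3 : ℝ) / N = 3 * (1 / N) := by ring
      have e3 : (0 : ℝ) < 1 / N := by positivity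
      linarith [h1 ν' x]
  have hlow : F ν x - 3 / N ≤ F ν' x := by
    have e1 : ((i : ℝ) + 1) / N = i / N + 1 / N := add_div _ _ _
    have e2 : (3 : ℝ) / N = 3 * (1 / N) := by ring
    have e3 : (0 : ℝ) < 1 / N := by positivity
    by_cases hlt : 2 ≤ i
    · obtain ⟨j, hj⟩ : ∃ j, i = j + 1 := ⟨i - 1, by omega⟩
      have e4 : (i : ℝ) / N = j / N + 1 / N := by rw [hj]; push_cast; exact add_div _ _ _
      have hjN : j < N := by
        have : (i : ℝ) ≤ N := hi1.trans (by nlinarith [h1 ν x])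
        have : i ≤ N := by exact_mod_cast this
        omega
      have hq := ht j (by omega) hjN
      have hx : t j ≤ x := by
        by_contra hx
        have := hmono ν (not_le.1 hx).le
        rw [hq] at this
        linarith
      have hc := (abs_lt.1 (hν' j (Finset.mem_range.2 hjN))).1
      have := hmono ν' hx
      rw [hq] at hc
      linarith
    · have : (i : ℝ) ≤ 1 := by exact_mod_cast (by omega : i ≤ 1)
      have : (i : ℝ) / N ≤ 1 / N := by gcongr
      linarith [h0 ν' x]
  rw [abs_le]
  constructor <;> linarith

lemma dLPE_lt_of_tendsto {ν : ProbabilityMeasure Ω2} {G : Ω2 → Ω2} (hG : Continuous G) {ε : ℝ≥0∞}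
    (hε : 0 < ε) : ∀ᶠ ν' : ProbabilityMeasure Ω2 in 𝓝 ν,
      levyProkhorovEDist ((ν' : Measure Ω2).map G) ((ν : Measure Ω2).map G) < ε := by
  have h := (LevyProkhorov.continuous_ofMeasure_probabilityMeasure (Ω := Ω2)).comp
    (ProbabilityMeasure.continuous_map hG)
  exact (h.tendsto ν).eventually (Metric.eball_mem_nhds _ hε)

/-- The map `𝒪` is weakly continuous at measures with atomless marginals. -/
lemma eventually_dLPE_Omap_lt {ν : ProbabilityMeasure Ω2} (hν : ν ∈ Mcal) {ε : ℝ} (hε : 0 < ε) :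
    ∀ᶠ ν' : ProbabilityMeasure Ω2 in 𝓝 ν,
      dLPE (Omap (ν' : Measure Ω2)) (Omap (ν : Measure Ω2)) < ENNReal.ofReal ε := by
  have hGc : Continuous fun q : Ω2 => (cdfX (ν : Measure Ω2) q.1, cdfY (ν : Measure Ω2) q.2) := by
    have hm1 := Measure.isProbabilityMeasure_map (μ := (ν : Measure Ω2)) measurable_fst.aemeasurable
    have hm2 := Measure.isProbabilityMeasure_map (μ := (ν : Measure Ω2)) measurable_snd.aemeasurable
    have h1 : ⇑(ProbabilityTheory.cdf ((ν : Measure Ω2).map Prod.fst)) = cdfX ν :=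
      funext fun x => cdf_map_apply _ measurable_fst x
    have h2 : ⇑(ProbabilityTheory.cdf ((ν : Measure Ω2).map Prod.snd)) = cdfY ν :=
      funext fun x => cdf_map_apply _ measurable_snd x
    exact ((h1 ▸ continuous_cdf hν.2.1 : Continuous (cdfX ν)).comp continuous_fst).prodMk
      ((h2 ▸ continuous_cdf hν.2.2 : Continuous (cdfY ν)).comp continuous_snd)
  filter_upwards [dLPE_lt_of_tendsto hGc (ENNReal.ofReal_pos.2 (half_pos hε)),
    eventually_cdf_close continuous_fst hν.2.1 (half_pos hε),
    eventually_cdf_close continuous_snd hν.2.2 (half_pos hε)] with ν' h1 h2 h3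
  have h4 : levyProkhorovEDist (Omap (ν' : Measure Ω2)) ((ν' : Measure Ω2).map
      fun q : Ω2 => (cdfX (ν : Measure Ω2) q.1, cdfY (ν : Measure Ω2) q.2))
      ≤ ENNReal.ofReal (ε / 2) := by
    refine levyProkhorovEDist_map_le _ (measurable_cdf_prod _) hGc.measurable (half_pos hε).le
      fun q => ?_
    rw [Prod.dist_eq]
    exact max_le (h2 q.1) (h3 q.2)
  calc dLPE (Omap (ν' : Measure Ω2)) (Omap (ν : Measure Ω2))
      ≤ _ + _ := levyProkhorovEDist_triangle _ _ _
    _ < ENNReal.ofReal (ε / 2) + ENNReal.ofReal (ε / 2) :=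
        ENNReal.add_lt_add_of_le_of_lt (h4.trans_lt ENNReal.ofReal_lt_top).ne h4 h1
    _ = ENNReal.ofReal ε := by
        rw [← ENNReal.ofReal_add (half_pos hε).le (half_pos hε).le, add_halves]

lemma exists_boundedContinuous_dual_of_measurable {μ ν : Measure Ω2} [IsProbabilityMeasure μ]
    [IsProbabilityMeasure ν] {c M : ℝ} {ψ : Ω2 → ℝ} (hψ : Measurable ψ) (hM : ∀ x, |ψ x| ≤ M)
    (hc : c < ∫ x, ψ x ∂ν + 1 - ∫ x, Real.exp (ψ x) ∂μ) :
    ∃ φ : BoundedContinuousFunction Ω2 ℝ, c < ∫ x, φ x ∂ν + 1 - ∫ x, Real.exp (φ x) ∂μ := by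
  have hM0 : 0 ≤ M := (abs_nonneg _).trans (hM 0)
  have hbdd : ∀ (m : Measure Ω2) [IsFiniteMeasure m] {f : Ω2 → ℝ} (C : ℝ), Measurable f →
      (∀ x, |f x| ≤ C) → Integrable f m := fun m _ f C hf hC =>
    Integrable.of_bound hf.aestronglyMeasurable C (Eventually.of_forall hC)
  set gap := ∫ x, ψ x ∂ν + 1 - ∫ x, Real.exp (ψ x) ∂μ - c with hgap
  have hgap0 : 0 < gap := by rw [hgap]; linarith
  set η := gap / (2 * (1 + Real.exp M)) with hη
  have hη0 : 0 < η := by positivity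
  obtain ⟨φ₀, hφ₀, -⟩ := (hbdd (μ + ν) M hψ hM).exists_boundedContinuous_integral_sub_le hη0
  let φ : BoundedContinuousFunction Ω2 ℝ := BoundedContinuousFunction.ofNormedAddCommGroup
    (fun x => max (-M) (min (φ₀ x) M)) (by fun_prop) M fun x => by
      rw [Real.norm_eq_abs, abs_le]
      exact ⟨le_max_left _ _, max_le (by linarith) (min_le_right _ _)⟩
  have hφ : ∀ x, φ x = max (-M) (min (φ₀ x) M) := fun _ => rfl
  have hφM : ∀ x, |φ x| ≤ M := fun x => by
    rw [hφ, abs_le]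
    exact ⟨le_max_left _ _, max_le (by linarith) (min_le_right _ _)⟩
  have hφm : Measurable φ := φ.continuous.measurable
  have hdiff : ∀ x, |ψ x - φ x| ≤ |ψ x - φ₀ x| := by
    intro x
    have hx := abs_le.1 (hM x)
    have : ψ x = max (-M) (min (ψ x) M) := by rw [min_eq_left hx.2, max_eq_right hx.1]
    conv_lhs => rw [this, hφ]
    calc |max (-M) (min (ψ x) M) - max (-M) (min (φ₀ x) M)|
        ≤ |min (ψ x) M - min (φ₀ x) M| := (abs_max_sub_max_le_max _ _ _ _).trans (by simp)
      _ ≤ |ψ x - φ₀ x| := (abs_min_sub_min_le_max _ _ _ _).trans (by simp)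
  have hint : ∫ x, |ψ x - φ x| ∂(μ + ν) ≤ η := by
    refine (integral_mono (hbdd _ (2 * M) (hψ.sub hφm).abs fun x => ?_) ?_ hdiff).trans hφ₀
    · rw [abs_abs]
      have h1 : |ψ x - φ x| ≤ |ψ x| + |φ x| := abs_sub _ _
      exact h1.trans (by linarith [hM x, hφM x])
    · exact ((hbdd (μ + ν) M hψ hM).sub (φ₀.integrable _)).abs
  have hi : ∀ (m : Measure Ω2) [IsFiniteMeasure m], Integrable (fun x => |ψ x - φ x|) m :=
    fun m _ => ((hbdd m M hψ hM).sub (hbdd m M hφm hφM)).abs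
  rw [integral_add_measure (hi μ) (hi ν)] at hint
  have hμ0 : 0 ≤ ∫ x, |ψ x - φ x| ∂μ := integral_nonneg fun _ => abs_nonneg _
  have hν0 : 0 ≤ ∫ x, |ψ x - φ x| ∂ν := integral_nonneg fun _ => abs_nonneg _
  have h1 : ∫ x, ψ x ∂ν - ∫ x, φ x ∂ν ≤ η := by
    rw [← integral_sub (hbdd ν M hψ hM) (hbdd ν M hφm hφM)]
    refine (integral_mono ((hbdd ν M hψ hM).sub (hbdd ν M hφm hφM)) (hi ν)
      fun x => le_abs_self _).trans (by linarith)
  have hexp : ∀ {f : Ω2 → ℝ}, Measurable f → (∀ x, |f x| ≤ M) →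
      Integrable (fun x => Real.exp (f x)) μ := fun hf hfM =>
    hbdd μ (Real.exp M) hf.exp fun x => by
      rw [Real.abs_exp]; exact Real.exp_le_exp.2 (abs_le.1 (hfM x)).2
  have h2 : ∫ x, Real.exp (φ x) ∂μ - ∫ x, Real.exp (ψ x) ∂μ ≤ Real.exp M * η := by
    rw [← integral_sub (hexp hφm hφM) (hexp hψ hM)]
    calc ∫ x, (Real.exp (φ x) - Real.exp (ψ x)) ∂μ
        ≤ ∫ x, Real.exp M * |ψ x - φ x| ∂μ := by
          refine integral_mono ((hexp hφm hφM).sub (hexp hψ hM)) ((hi μ).const_mul _) fun x => ?_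
          have e1 : Real.exp (ψ x) = Real.exp (φ x) * Real.exp (ψ x - φ x) := by
            rw [← Real.exp_add]; ring_nf
          have e2 := Real.add_one_le_exp (ψ x - φ x)
          have e3 : Real.exp (φ x) ≤ Real.exp M := Real.exp_le_exp.2 (abs_le.1 (hφM x)).2
          have e4 := neg_abs_le (ψ x - φ x)
          have e5 := Real.exp_pos (φ x)
          calc Real.exp (φ x) - Real.exp (ψ x)
              ≤ Real.exp (φ x) * |ψ x - φ x| := by rw [e1]; nlinarith
            _ ≤ Real.exp M * |ψ x - φ x| := by gcongr
      _ = Real.exp M * ∫ x, |ψ x - φ x| ∂μ := integral_const_mul _ _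
      _ ≤ Real.exp M * η := by
          have := Real.exp_pos M
          gcongr
          linarith
  refine ⟨φ, ?_⟩
  have h3 : (1 + Real.exp M) * η = gap / 2 := by
    rw [hη]; field_simp
  linarith

/-- Truncation of a density to `[1/M, M]`. -/
def clip (M x : ℝ) : ℝ := max M⁻¹ (min x M)

lemma clip_pos {M : ℝ} (hM : 1 ≤ M) (x : ℝ) : 0 < clip M x :=
  (inv_pos.2 (by linarith)).trans_le (le_max_left _ _)

lemma clip_le {M : ℝ} (hM : 1 ≤ M) (x : ℝ) : clip M x ≤ M :=
  max_le ((inv_le_one_of_one_le₀ hM).trans hM) (min_le_right _ _)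

lemma mul_log_clip_nonneg {M : ℝ} (hM : 1 ≤ M) (x : ℝ) :
    0 ≤ x * Real.log (clip M x) + 1 - clip M x := by
  set y := clip M x with hy
  have hy0 : 0 < y := clip_pos hM x
  have h1 : 0 ≤ (x - y) * Real.log y := by
    have hM0 : 0 < M := by linarith
    have hM1 : M⁻¹ ≤ 1 := inv_le_one_of_one_le₀ hM
    rcases lt_or_ge x M⁻¹ with h | h
    · have : y = M⁻¹ := max_eq_left ((min_le_left _ _).trans h.le)
      rw [this]
      exact mul_nonneg_of_nonpos_of_nonpos (by linarith)
        (Real.log_nonpos (inv_pos.2 hM0).le hM1)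
    · rcases le_or_gt x M with h' | h'
      · have : y = x := by rw [hy, clip, min_eq_left h', max_eq_right h]
        simp [this]
      · have : y = M := by rw [hy, clip, min_eq_right h'.le, max_eq_right (hM1.trans hM)]
        rw [this]
        exact mul_nonneg (by linarith) (Real.log_nonneg hM)
  have h2 : 1 - y⁻¹ ≤ Real.log y := Real.one_sub_inv_le_log_of_pos hy0
  have h3 : y * (1 - y⁻¹) ≤ y * Real.log y := by gcongr
  rw [mul_sub, mul_inv_cancel₀ hy0.ne'] at h3
  linarith

lemma tendsto_mul_log_clip {x : ℝ} (hx : 0 ≤ x) :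
    Tendsto (fun m : ℕ => x * Real.log (clip (m + 1) x) + 1 - clip (m + 1) x) atTop
      (𝓝 (x * Real.log x + 1 - x)) := by
  have h0 : Tendsto (fun m : ℕ => ((m : ℝ) + 1)) atTop atTop :=
    tendsto_atTop_add_const_right _ _ tendsto_natCast_atTop_atTop
  have h1 : Tendsto (fun m : ℕ => clip (m + 1) x) atTop (𝓝 x) := by
    have h2 : Tendsto (fun m : ℕ => min x ((m : ℝ) + 1)) atTop (𝓝 x) :=
      tendsto_const_nhds.congr' ((h0.eventually_ge_atTop x).mono fun m hm => (min_eq_left hm).symm)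
    have := (tendsto_inv_atTop_zero.comp h0).max h2
    rwa [max_eq_right hx] at this
  rcases hx.eq_or_lt with rfl | hx
  · simpa using (tendsto_const_nhds (x := (1 : ℝ))).sub h1
  · exact (((h1.log hx.ne').const_mul x).add_const 1).sub h1

/-- The Donsker–Varadhan duality for the Kullback–Leibler divergence, in linearised form. -/
lemma exists_boundedContinuous_dual {μ ν : Measure Ω2} [IsProbabilityMeasure μ]
    [IsProbabilityMeasure ν] {c : ℝ} (hc : c < 0 ∨ ENNReal.ofReal c < KL ν μ) :
    ∃ φ : BoundedContinuousFunction Ω2 ℝ, c < ∫ x, φ x ∂ν + 1 - ∫ x, Real.exp (φ x) ∂μ := by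
  rcases hc with hc | hc
  · exact ⟨0, by simpa using hc⟩
  by_cases hac : ν ≪ μ
  · rw [KL, if_pos hac] at hc
    set g : Ω2 → ℝ := fun z => (ν.rnDeriv μ z).toReal with hg
    have hgm : Measurable g := (Measure.measurable_rnDeriv ν μ).ennreal_toReal
    have hclm : ∀ M : ℝ, Measurable fun z => clip M (g z) := fun M =>
      measurable_const.max (hgm.min measurable_const)
    have hFm : ∀ m : ℕ, Measurable fun z =>
        g z * Real.log (clip (m + 1) (g z)) + 1 - clip (m + 1) (g z) := fun m =>
      ((hgm.mul (hclm _).log).add_const 1).sub (hclm _)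
    have hfatou := lintegral_liminf_le (μ := μ) (u := atTop) fun m : ℕ =>
      (hFm m).ennreal_ofReal
    have hlim : ∀ z, liminf (fun m : ℕ => ENNReal.ofReal
        (g z * Real.log (clip (m + 1) (g z)) + 1 - clip (m + 1) (g z))) atTop
        = ENNReal.ofReal (g z * Real.log (g z) + 1 - g z) := fun z =>
      (ENNReal.tendsto_ofReal (tendsto_mul_log_clip ENNReal.toReal_nonneg)).liminf_eq
    simp_rw [hlim] at hfatou
    obtain ⟨m, hm⟩ := (eventually_lt_of_lt_liminf (hc.trans_le hfatou)).exists
    have hM : (1 : ℝ) ≤ m + 1 := by linarith [Nat.cast_nonneg (α := ℝ) m]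
    set ψ : Ω2 → ℝ := fun z => Real.log (clip (m + 1) (g z)) with hψ
    have hψm : Measurable ψ := (hclm _).log
    have hψb : ∀ z, |ψ z| ≤ Real.log (m + 1) := by
      intro z
      rw [abs_le, ← Real.log_inv]
      exact ⟨Real.log_le_log (inv_pos.2 (by linarith)) (le_max_left _ _),
        Real.log_le_log (clip_pos hM _) (clip_le hM _)⟩
    have hexp : ∀ z, Real.exp (ψ z) = clip (m + 1) (g z) := fun z => Real.exp_log (clip_pos hM _)
    have hi2 : Integrable (fun z => clip (m + 1) (g z)) μ :=
      Integrable.of_bound (hclm _).aestronglyMeasurable (m + 1) (Eventually.of_forall fun z => by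
        rw [Real.norm_eq_abs, abs_of_pos (clip_pos hM _)]; exact clip_le hM _)
    have hi1 : Integrable (fun z => g z * ψ z) μ :=
      Measure.integrable_toReal_rnDeriv.mul_bdd (c := Real.log (m + 1)) hψm.aestronglyMeasurable
        (Eventually.of_forall hψb)
    have hi3 : Integrable (fun z => g z * ψ z + 1) μ := hi1.add (integrable_const 1)
    have hi4 : Integrable (fun z => g z * ψ z + 1 - clip (m + 1) (g z)) μ := hi3.sub hi2
    refine exists_boundedContinuous_dual_of_measurable hψm hψb ?_
    have heq : ∫ z, ψ z ∂ν + 1 - ∫ z, Real.exp (ψ z) ∂μ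
        = ∫ z, (g z * ψ z + 1 - clip (m + 1) (g z)) ∂μ := by
      rw [integral_sub hi3 hi2, integral_add hi1 (integrable_const 1),
        ← integral_rnDeriv_smul hac]
      simp [hexp, hg]
    rw [heq]
    rw [← ofReal_integral_eq_lintegral_ofReal hi4
      (Eventually.of_forall fun z => mul_log_clip_nonneg hM _)] at hm
    exact lt_of_not_ge fun h => hm.not_ge (ENNReal.ofReal_le_ofReal h)
  · obtain ⟨A, hA, hμA, hνA⟩ : ∃ A, MeasurableSet A ∧ μ A = 0 ∧ ν A ≠ 0 := by
      by_contra! h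
      exact hac (Measure.AbsolutelyContinuous.mk h)
    have hpos : 0 < ν.real A := ENNReal.toReal_pos hνA (measure_ne_top _ _)
    set M := (|c| + 1) / ν.real A with hM
    have hM0 : 0 ≤ M := by positivity
    refine exists_boundedContinuous_dual_of_measurable (ψ := A.indicator fun _ => M) (M := M)
      (measurable_const.indicator hA) (fun x => ?_) ?_
    · by_cases hx : x ∈ A <;> simp [hx, hM0, abs_of_nonneg]
    · have h1 : ∫ x, Real.exp (A.indicator (fun _ => M) x) ∂μ = 1 := by
        rw [integral_congr_ae (g := fun _ => 1)]
        · simp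
        · filter_upwards [measure_eq_zero_iff_ae_notMem.1 hμA] with x hx
          simp [hx]
      have h2 : M * ν.real A = |c| + 1 := div_mul_cancel₀ _ hpos.ne'
      rw [h1, integral_indicator_const _ hA, smul_eq_mul]
      linarith [le_abs_self c]

lemma pi_withDensity {n : ℕ} {μ : Measure Ω2} [IsProbabilityMeasure μ] {g : Ω2 → ℝ≥0∞}
    (hg : Measurable g) [SigmaFinite (μ.withDensity g)] :
    (Measure.pi fun _ : Fin n => μ.withDensity g)
      = (Measure.pi fun _ : Fin n => μ).withDensity fun z => ∏ i, g (z i) := by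
  refine Measure.pi_eq fun A hA => ?_
  have hind : ∀ z : Fin n → Ω2, (Set.univ.pi A).indicator (fun z => ∏ i, g (z i)) z
      = ∏ i, (A i).indicator g (z i) := by
    intro z
    by_cases hz : ∀ i, z i ∈ A i
    · rw [Set.indicator_of_mem (by simpa using hz)]
      exact Finset.prod_congr rfl fun i _ => (Set.indicator_of_mem (hz i) _).symm
    · rw [Set.indicator_of_notMem (by simpa using hz)]
      obtain ⟨i, hi⟩ := not_forall.1 hz
      exact (Finset.prod_eq_zero (Finset.mem_univ i) (Set.indicator_of_notMem hi _)).symm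
  rw [withDensity_apply _ (MeasurableSet.univ_pi hA),
    ← lintegral_indicator (MeasurableSet.univ_pi hA)]
  simp_rw [hind]
  have hm : ∀ i, Measurable ((A i).indicator g) := fun i => hg.indicator (hA i)
  rw [ProbabilityTheory.lintegral_prod_eq_prod_lintegral_of_indepFun Finset.univ
    (fun i (z : Fin n → Ω2) => (A i).indicator g (z i))
    (ProbabilityTheory.iIndepFun_pi fun i => (hm i).aemeasurable)
    fun i => (hm i).comp (measurable_pi_apply i)]
  refine Finset.prod_congr rfl fun i _ => ?_
  rw [(measurePreserving_eval (fun _ : Fin n => μ) i).lintegral_comp (hm i),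
    lintegral_indicator (hA i), withDensity_apply _ (hA i)]

lemma ofReal_exp_integral_le {α : Type*} [MeasurableSpace α] {P : Measure α}
    [IsProbabilityMeasure P] {X : α → ℝ} (hX : Integrable X P) :
    ENNReal.ofReal (Real.exp (∫ x, X x ∂P)) ≤ ∫⁻ x, ENNReal.ofReal (Real.exp (X x)) ∂P := by
  by_cases h : ∫⁻ x, ENNReal.ofReal (Real.exp (X x)) ∂P = ∞
  · simp [h]
  have hi : Integrable (fun x => Real.exp (X x)) P :=
    (lintegral_ofReal_ne_top_iff_integrable
      (Real.continuous_exp.comp_aestronglyMeasurable hX.aestronglyMeasurable)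
      (Eventually.of_forall fun _ => (Real.exp_pos _).le)).1 h
  rw [← ofReal_integral_eq_lintegral_ofReal hi (Eventually.of_forall fun _ => (Real.exp_pos _).le)]
  exact ENNReal.ofReal_le_ofReal (convexOn_exp.map_integral_le Real.continuous_exp.continuousOn
    isClosed_univ (Eventually.of_forall fun _ => Set.mem_univ _) hX hi)

lemma KL_eq_klDiv (ν μ : Measure Ω2) [IsProbabilityMeasure ν] [IsProbabilityMeasure μ] :
    KL ν μ = InformationTheory.klDiv ν μ := by
  rw [InformationTheory.klDiv_eq_lintegral_klFun, KL]
  rfl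

/-- The Gibbs variational lower bound, for product measures. -/
lemma ofReal_exp_sub_KL_le {n : ℕ} {μ ν : Measure Ω2} [IsProbabilityMeasure μ]
    [IsProbabilityMeasure ν] (hKL : KL ν μ ≠ ∞) {f : (Fin n → Ω2) → ℝ} (hf : Measurable f)
    (hfi : Integrable f (Measure.pi fun _ => ν)) :
    ENNReal.ofReal (Real.exp (∫ z, f z ∂(Measure.pi fun _ => ν) - n * (KL ν μ).toReal))
      ≤ ∫⁻ z, ENNReal.ofReal (Real.exp (f z)) ∂(Measure.pi fun _ => μ) := by
  rw [KL_eq_klDiv] at hKL ⊢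
  obtain ⟨hac, hllr⟩ := InformationTheory.klDiv_ne_top_iff.1 hKL
  set g := ν.rnDeriv μ with hg
  have hgm : Measurable g := Measure.measurable_rnDeriv ν μ
  set G : (Fin n → Ω2) → ℝ≥0∞ := fun z => ∏ i, g (z i) with hG
  have hGm : Measurable G := Finset.univ.measurable_prod fun i _ =>
    hgm.comp (measurable_pi_apply i)
  have hpi : (Measure.pi fun _ : Fin n => ν) = (Measure.pi fun _ : Fin n => μ).withDensity G := by
    have hν : μ.withDensity g = ν := Measure.withDensity_rnDeriv_eq ν μ hac
    have : SigmaFinite (μ.withDensity g) := by rw [hν]; infer_instance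
    rw [← pi_withDensity hgm, hν]
  have hlli : ∀ i : Fin n, Integrable (fun z : Fin n → Ω2 => llr ν μ (z i))
      (Measure.pi fun _ => ν) := fun i => integrable_comp_eval (μ := fun _ : Fin n => ν) hllr
  have hsum : Integrable (fun z : Fin n → Ω2 => ∑ i, llr ν μ (z i)) (Measure.pi fun _ => ν) :=
    integrable_finsetSum _ fun i _ => hlli i
  have hint : ∫ z, (f z - ∑ i, llr ν μ (z i)) ∂(Measure.pi fun _ => ν)
      = ∫ z, f z ∂(Measure.pi fun _ => ν) - n * (InformationTheory.klDiv ν μ).toReal := by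
    rw [integral_sub hfi hsum, integral_finsetSum _ fun i _ => hlli i,
      InformationTheory.toReal_klDiv_of_measure_eq hac (by simp)]
    congr 1
    rw [Finset.sum_congr rfl fun i _ => integral_comp_eval (μ := fun _ : Fin n => ν)
      hllr.aestronglyMeasurable]
    simp
  have hae : ∀ᵐ z ∂(Measure.pi fun _ : Fin n => ν),
      ENNReal.ofReal (Real.exp (f z - ∑ i, llr ν μ (z i)))
        = ENNReal.ofReal (Real.exp (f z)) * (G z)⁻¹ := by
    have h1 : ∀ᵐ x ∂ν, ENNReal.ofReal (Real.exp (llr ν μ x)) = g x := by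
      filter_upwards [exp_llr_of_ac ν μ hac, hac.ae_le (Measure.rnDeriv_lt_top ν μ)] with x hx hx'
      rw [hx, ENNReal.ofReal_toReal hx'.ne]
    have h2 : ∀ᵐ z ∂(Measure.pi fun _ : Fin n => ν), ∀ i,
        ENNReal.ofReal (Real.exp (llr ν μ (z i))) = g (z i) :=
      ae_all_iff.2 fun i => (measurePreserving_eval (fun _ : Fin n => ν) i).quasiMeasurePreserving.ae h1
    filter_upwards [h2] with z hz
    have : G z = ENNReal.ofReal (Real.exp (∑ i, llr ν μ (z i))) := by
      rw [Real.exp_sum, ENNReal.ofReal_prod_of_nonneg fun i _ => (Real.exp_pos _).le]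
      exact Finset.prod_congr rfl fun i _ => (hz i).symm
    rw [this, ← ENNReal.ofReal_inv_of_pos (Real.exp_pos _), ← ENNReal.ofReal_mul (Real.exp_pos _).le,
      ← Real.exp_neg, ← Real.exp_add, sub_eq_add_neg]
  have hFm : Measurable fun z => ENNReal.ofReal (Real.exp (f z)) := hf.exp.ennreal_ofReal
  calc ENNReal.ofReal (Real.exp (∫ z, f z ∂(Measure.pi fun _ => ν)
          - n * (InformationTheory.klDiv ν μ).toReal))
      ≤ ∫⁻ z, ENNReal.ofReal (Real.exp (f z - ∑ i, llr ν μ (z i))) ∂(Measure.pi fun _ => ν) := by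
        rw [← hint]
        exact ofReal_exp_integral_le (hfi.sub hsum)
    _ = ∫⁻ z, ENNReal.ofReal (Real.exp (f z)) * (G z)⁻¹ ∂(Measure.pi fun _ => ν) :=
        lintegral_congr_ae hae
    _ = ∫⁻ z, G z * (ENNReal.ofReal (Real.exp (f z)) * (G z)⁻¹) ∂(Measure.pi fun _ => μ) := by
        rw [hpi]
        exact lintegral_withDensity_eq_lintegral_mul _ hGm (hFm.mul hGm.inv)
    _ ≤ ∫⁻ z, ENNReal.ofReal (Real.exp (f z)) ∂(Measure.pi fun _ => μ) := by
        refine lintegral_mono fun z => ?_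
        rw [mul_left_comm]
        exact mul_le_of_le_one_right' (ENNReal.mul_inv_le_one _)

lemma measurable_tEmp {k n : ℕ} (σ : Equiv.Perm (Fin k)) :
    Measurable (tEmp σ : (Fin n → Ω2) → ℝ) := by
  refine (Finset.univ.measurable_sum fun s _ => ?_).const_mul _
  exact (measurable_hPat σ).comp (measurable_pi_lambda _ fun i => measurable_pi_apply (s i))

lemma tEmp_mem_Icc {k n : ℕ} [NeZero n] (σ : Equiv.Perm (Fin k)) (z : Fin n → Ω2) :
    tEmp σ z ∈ Set.Icc (0 : ℝ) 1 := by
  rw [← tPat_empM]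
  exact tPat_mem_Icc σ _

lemma hPat_comp_of_not_injective {k n : ℕ} (σ : Equiv.Perm (Fin k)) (z : Fin n → Ω2)
    {s : Fin k → Fin n} (hs : ¬ Function.Injective s) : hPat σ (z ∘ s) = 0 := by
  rw [hPat_eq_indicator, Set.indicator_of_notMem]
  rintro ⟨τ, hτ, -⟩
  refine hs fun i j hij => τ.symm.injective (hτ.injective ?_)
  simp [hij]

lemma integral_tEmp {k n : ℕ} (σ : Equiv.Perm (Fin k)) (ν : Measure Ω2) [IsProbabilityMeasure ν] :
    ∫ z, tEmp σ z ∂(Measure.pi fun _ : Fin n => ν)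
      = (n.descFactorial k / (n : ℝ) ^ k) * tPat σ ν := by
  classical
  have hm : ∀ s : Fin k → Fin n, Measurable fun z : Fin n → Ω2 => z ∘ s := fun s =>
    measurable_pi_lambda _ fun i => measurable_pi_apply (s i)
  have hi : ∀ s : Fin k → Fin n, Integrable (fun z : Fin n → Ω2 => hPat σ (z ∘ s))
      (Measure.pi fun _ => ν) := fun s =>
    Integrable.of_bound ((measurable_hPat σ).comp (hm s)).aestronglyMeasurable 1
      (Eventually.of_forall fun z => by
        rw [hPat]; split_ifs <;> simp)
  have hterm : ∀ s : Fin k → Fin n, ∫ z, hPat σ (z ∘ s) ∂(Measure.pi fun _ : Fin n => ν)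
      = if Function.Injective s then tPat σ ν else 0 := by
    intro s
    split_ifs with hs
    · rw [tPat, ← pi_map_comp_injective ν hs, integral_map (hm s).aemeasurable
        (measurable_hPat σ).aestronglyMeasurable]
    · simp [hPat_comp_of_not_injective σ _ hs]
  have hcard : (Finset.univ.filter fun s : Fin k → Fin n => Function.Injective s).card
      = n.descFactorial k := by
    rw [← Fintype.card_subtype, Fintype.card_congr (Equiv.subtypeInjectiveEquivEmbedding _ _),
      Fintype.card_embedding_eq, Fintype.card_fin, Fintype.card_fin]
  simp only [tEmp]
  rw [integral_const_mul, integral_finsetSum _ fun s _ => hi s]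
  simp_rw [hterm]
  rw [← Finset.sum_filter, Finset.sum_const, hcard, nsmul_eq_mul]
  ring

lemma tendsto_descFactorial_div (k : ℕ) :
    Tendsto (fun n : ℕ => (n.descFactorial k / (n : ℝ) ^ k)) atTop (𝓝 1) := by
  have h := isEquivalent_descFactorial k
  refine (Asymptotics.isEquivalent_iff_tendsto_one ?_).1 h
  filter_upwards [eventually_ge_atTop 1] with n hn
  positivity

lemma lintegral_exp_sum_le {n : ℕ} (μ : Measure Ω2) [IsProbabilityMeasure μ]
    (φ : BoundedContinuousFunction Ω2 ℝ) :
    ∫⁻ z, ENNReal.ofReal (Real.exp (∑ i, φ (z i))) ∂(Measure.pi fun _ : Fin n => μ)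
      ≤ ENNReal.ofReal (Real.exp (n * (∫ x, Real.exp (φ x) ∂μ - 1))) := by
  have hm : Measurable fun z : Fin n → Ω2 => ∑ i, φ (z i) :=
    Finset.univ.measurable_sum fun i _ => φ.continuous.measurable.comp (measurable_pi_apply i)
  have hi : Integrable (fun z : Fin n → Ω2 => Real.exp (∑ i, φ (z i)))
      (Measure.pi fun _ => μ) := by
    refine Integrable.of_bound hm.exp.aestronglyMeasurable (Real.exp (n * ‖φ‖))
      (Eventually.of_forall fun z => ?_)
    rw [Real.norm_eq_abs, Real.abs_exp]
    refine Real.exp_le_exp.2 ((Finset.sum_le_sum fun i _ =>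
      (le_abs_self _).trans (φ.norm_coe_le_norm (z i))).trans (by simp))
  rw [← ofReal_integral_eq_lintegral_ofReal hi (Eventually.of_forall fun _ => (Real.exp_pos _).le)]
  refine ENNReal.ofReal_le_ofReal ?_
  simp_rw [Real.exp_sum]
  rw [integral_fintype_prod_eq_pow (ι := Fin n) (fun x => Real.exp (φ x)), Fintype.card_fin,
    Real.exp_nat_mul]
  refine pow_le_pow_left₀ (integral_nonneg fun _ => (Real.exp_pos _).le) ?_ n
  linarith [Real.add_one_le_exp (∫ x, Real.exp (φ x) ∂μ - 1)]

lemma integral_empM {n : ℕ} [NeZero n] (z : Fin n → Ω2) (φ : BoundedContinuousFunction Ω2 ℝ) :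
    n * ∫ x, φ x ∂(empM z) = ∑ i, φ (z i) := by
  rw [empM, integral_smul_measure, integral_finsetSum_measure fun i _ => φ.integrable _]
  have : (n : ℝ) ≠ 0 := Nat.cast_ne_zero.2 (NeZero.ne n)
  simp [this]

/-- The unnormalised Gibbs weight of a set of configurations. -/
def gibbsWeight {k : ℕ} (σ : Equiv.Perm (Fin k)) (μ : Measure Ω2) (θ : ℝ) (n : ℕ)
    (A : Set (Fin n → Ω2)) : ℝ≥0∞ :=
  ∫⁻ z in A, ENNReal.ofReal (Real.exp (n * θ * tEmp σ z)) ∂pmeas μ n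

instance (μ : Measure Ω2) [IsProbabilityMeasure μ] (n : ℕ) : IsProbabilityMeasure (pmeas μ n) :=
  inferInstanceAs (IsProbabilityMeasure (Measure.pi _))

lemma measurable_gibbs_exponent {k n : ℕ} (σ : Equiv.Perm (Fin k)) (θ : ℝ) :
    Measurable fun z : Fin n → Ω2 => n * θ * tEmp σ z :=
  (measurable_tEmp σ).const_mul _

lemma abs_gibbs_exponent_le {k n : ℕ} [NeZero n] (σ : Equiv.Perm (Fin k)) (θ : ℝ)
    (z : Fin n → Ω2) : |n * θ * tEmp σ z| ≤ n * |θ| := by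
  obtain ⟨h0, h1⟩ := tEmp_mem_Icc σ z
  rw [abs_mul, abs_mul, abs_of_nonneg h0, Nat.abs_cast]
  exact mul_le_of_le_one_right (by positivity) h1

lemma Qgibbs_apply {k n : ℕ} [NeZero n] (σ : Equiv.Perm (Fin k)) {μ : ProbabilityMeasure Ω2}
    (hμ : μ ∈ Mcal) (θ : ℝ) (A : Set (Fin n → Ω2)) :
    Qgibbs σ (μ : Measure Ω2) θ n A
      = gibbsWeight σ (μ : Measure Ω2) θ n A / gibbsWeight σ (μ : Measure Ω2) θ n Set.univ := by
  have hgen : ∀ᵐ z ∂pmeas (μ : Measure Ω2) n, tPerm σ (inducedPerm z) = tEmp σ z :=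
    (ae_isGeneric hμ).mono fun z hz => tPerm_inducedPerm σ hz
  have hi : Integrable (fun z => Real.exp (n * θ * tEmp σ z)) (pmeas (μ : Measure Ω2) n) := by
    refine Integrable.of_bound (measurable_gibbs_exponent σ θ).exp.aestronglyMeasurable
      (Real.exp (n * |θ|)) (Eventually.of_forall fun z => ?_)
    rw [Real.norm_eq_abs, Real.abs_exp]
    exact Real.exp_le_exp.2 ((le_abs_self _).trans (abs_gibbs_exponent_le σ θ z))
  have hZ : gibbsWeight σ (μ : Measure Ω2) θ n Set.univ
      = ENNReal.ofReal (∫ z, Real.exp (n * θ * tEmp σ z) ∂pmeas (μ : Measure Ω2) n) := by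
    rw [gibbsWeight, Measure.restrict_univ, ofReal_integral_eq_lintegral_ofReal hi
      (Eventually.of_forall fun _ => (Real.exp_pos _).le)]
  have hpos : 0 < ∫ z, Real.exp (n * θ * tEmp σ z) ∂pmeas (μ : Measure Ω2) n :=
    integral_exp_pos hi
  have hF : Fn σ (μ : Measure Ω2) θ n
      = Real.log (∫ z, Real.exp (n * θ * tEmp σ z) ∂pmeas (μ : Measure Ω2) n) := by
    rw [Fn, integral_congr_ae]
    exact hgen.mono fun z hz => by simp only [hz]
  rw [Qgibbs, withDensity_apply' _ A, hZ, gibbsWeight, ENNReal.div_eq_inv_mul,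
    ← lintegral_const_mul _ (measurable_gibbs_exponent σ θ).exp.ennreal_ofReal]
  refine lintegral_congr_ae (ae_restrict_of_ae (hgen.mono fun z hz => ?_))
  simp only [hz]
  rw [hF, Real.exp_sub, Real.exp_log hpos, ENNReal.ofReal_div_of_pos hpos, ENNReal.div_eq_inv_mul]

lemma gibbsWeight_univ_ne_top {k n : ℕ} [NeZero n] (σ : Equiv.Perm (Fin k)) (μ : Measure Ω2)
    [IsProbabilityMeasure μ] (θ : ℝ) : gibbsWeight σ μ θ n Set.univ ≠ ∞ := by
  have h : gibbsWeight σ μ θ n Set.univ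
      ≤ ∫⁻ _, ENNReal.ofReal (Real.exp (n * |θ|)) ∂pmeas μ n := by
    rw [gibbsWeight, Measure.restrict_univ]
    exact lintegral_mono fun z => ENNReal.ofReal_le_ofReal
      (Real.exp_le_exp.2 ((le_abs_self _).trans (abs_gibbs_exponent_le σ θ z)))
  refine (h.trans_lt ?_).ne
  simp

lemma le_gibbsWeight_univ {k n : ℕ} [NeZero n] (σ : Equiv.Perm (Fin k)) {μ ν : Measure Ω2}
    [IsProbabilityMeasure μ] [IsProbabilityMeasure ν] (θ : ℝ) (hKL : KL ν μ ≠ ∞) :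
    ENNReal.ofReal (Real.exp (n * (θ * (n.descFactorial k / (n : ℝ) ^ k) * tPat σ ν
      - (KL ν μ).toReal))) ≤ gibbsWeight σ μ θ n Set.univ := by
  have hi : Integrable (fun z : Fin n → Ω2 => n * θ * tEmp σ z) (Measure.pi fun _ => ν) :=
    Integrable.of_bound (measurable_gibbs_exponent σ θ).aestronglyMeasurable (n * |θ|)
      (Eventually.of_forall fun z => abs_gibbs_exponent_le σ θ z)
  have h := ofReal_exp_sub_KL_le hKL (measurable_gibbs_exponent σ θ) hi
  rw [integral_const_mul, integral_tEmp] at h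
  rw [gibbsWeight, Measure.restrict_univ, pmeas]
  convert h using 3
  ring

lemma gibbsWeight_le {k n : ℕ} [NeZero n] (σ : Equiv.Perm (Fin k)) {μ : Measure Ω2}
    [IsProbabilityMeasure μ] {θ a : ℝ} {φ : BoundedContinuousFunction Ω2 ℝ}
    {A : Set (Fin n → Ω2)} (hA : ∀ z ∈ A, θ * tPat σ (empM z) ≤ a + ∫ x, φ x ∂(empM z)) :
    gibbsWeight σ μ θ n A
      ≤ ENNReal.ofReal (Real.exp (n * (a + (∫ x, Real.exp (φ x) ∂μ - 1)))) := by
  have hm : Measurable fun z : Fin n → Ω2 => ENNReal.ofReal (Real.exp (∑ i, φ (z i))) :=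
    (Finset.univ.measurable_sum fun i _ =>
      φ.continuous.measurable.comp (measurable_pi_apply i)).exp.ennreal_ofReal
  calc gibbsWeight σ μ θ n A
      ≤ ∫⁻ z in A, ENNReal.ofReal (Real.exp (n * a))
          * ENNReal.ofReal (Real.exp (∑ i, φ (z i))) ∂pmeas μ n := by
        refine setLIntegral_mono (hm.const_mul _) fun z hz => ?_
        rw [← ENNReal.ofReal_mul (Real.exp_pos _).le, ← Real.exp_add]
        refine ENNReal.ofReal_le_ofReal (Real.exp_le_exp.2 ?_)
        have h := mul_le_mul_of_nonneg_left (hA z hz) (Nat.cast_nonneg n : (0 : ℝ) ≤ n)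
        rw [mul_add, integral_empM, tPat_empM] at h
        linarith
    _ ≤ ∫⁻ z, ENNReal.ofReal (Real.exp (n * a))
          * ENNReal.ofReal (Real.exp (∑ i, φ (z i))) ∂pmeas μ n := setLIntegral_le_lintegral _ _
    _ ≤ ENNReal.ofReal (Real.exp (n * a))
          * ENNReal.ofReal (Real.exp (n * (∫ x, Real.exp (φ x) ∂μ - 1))) := by
        rw [lintegral_const_mul _ hm]
        gcongr
        exact lintegral_exp_sum_le μ φ
    _ = ENNReal.ofReal (Real.exp (n * (a + (∫ x, Real.exp (φ x) ∂μ - 1)))) := by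
        rw [← ENNReal.ofReal_mul (Real.exp_pos _).le, ← Real.exp_add, mul_add]

/-- The configurations whose empirical measure lies in `U`. -/
def empIn (n : ℕ) (U : Set (ProbabilityMeasure Ω2)) : Set (Fin n → Ω2) :=
  {z | ∃ q ∈ U, (q : Measure Ω2) = empM z}

/-- Exponential decay of the Gibbs probability near measures beaten by a competitor `ν`. -/
lemma tendsto_Qgibbs_empIn {k : ℕ} (σ : Equiv.Perm (Fin k)) {μ : ProbabilityMeasure Ω2}
    (hμ : μ ∈ Mcal) {θ a : ℝ} {ν : Measure Ω2} [IsProbabilityMeasure ν] (hKL : KL ν μ ≠ ∞)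
    {φ : BoundedContinuousFunction Ω2 ℝ} {U : Set (ProbabilityMeasure Ω2)}
    (hU : ∀ q ∈ U, θ * tPat σ (q : Measure Ω2) ≤ a + ∫ x, φ x ∂(q : Measure Ω2))
    (ha : a + (∫ x, Real.exp (φ x) ∂(μ : Measure Ω2) - 1) < θ * tPat σ ν - (KL ν μ).toReal) :
    Tendsto (fun n => Qgibbs σ (μ : Measure Ω2) θ n (empIn n U)) atTop (𝓝 0) := by
  set u := a + (∫ x, Real.exp (φ x) ∂(μ : Measure Ω2) - 1) with hu
  set v : ℕ → ℝ := fun n => θ * (n.descFactorial k / (n : ℝ) ^ k) * tPat σ ν - (KL ν μ).toReal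
    with hv
  have hlim : Tendsto (fun n => u - v n) atTop (𝓝 (u - (θ * tPat σ ν - (KL ν μ).toReal))) := by
    have h := ((((tendsto_descFactorial_div k).const_mul θ).mul_const (tPat σ ν)).sub_const
      (KL ν μ).toReal).const_sub u
    rwa [mul_one] at h
  have hbot : Tendsto (fun n : ℕ => (n : ℝ) * (u - v n)) atTop atBot :=
    tendsto_natCast_atTop_atTop.atTop_mul_neg (by linarith) hlim
  have h0 : Tendsto (fun n : ℕ => ENNReal.ofReal (Real.exp (n * (u - v n)))) atTop (𝓝 0) := by
    simpa using ENNReal.tendsto_ofReal (Real.tendsto_exp_atBot.comp hbot)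
  refine tendsto_of_tendsto_of_tendsto_of_le_of_le' tendsto_const_nhds h0
    (Eventually.of_forall fun _ => zero_le) ?_
  filter_upwards [eventually_ge_atTop 1] with n hn
  have : NeZero n := ⟨by omega⟩
  rw [Qgibbs_apply σ hμ, mul_sub, Real.exp_sub, ENNReal.ofReal_div_of_pos (Real.exp_pos _)]
  refine ENNReal.div_le_div (gibbsWeight_le σ ?_) (le_gibbsWeight_univ σ θ hKL)
  rintro z ⟨q, hq, hqz⟩
  rw [← hqz]
  exact hU q hq

lemma measurableSet_unitSq : MeasurableSet unitSq := measurableSet_Icc.prod measurableSet_Icc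

lemma mem_Pcal_iff_compl (ν : ProbabilityMeasure Ω2) :
    ν ∈ Pcal ↔ (ν : Measure Ω2) unitSqᶜ = 0 :=
  (prob_compl_eq_zero_iff measurableSet_unitSq).symm

lemma isCompact_Pcal : IsCompact Pcal := by
  have h := isCompact_setOfPred_probabilityMeasure_mass_eq_compl_isCompact_le (E := Ω2)
    (u := fun _ => 0) (K := fun _ => unitSq) tendsto_const_nhds
    (fun _ => isCompact_Icc.prod isCompact_Icc) (Or.inr monotone_const)
  convert h using 1
  ext ν
  simp only [mem_Pcal_iff_compl, Set.mem_ofPred_eq, forall_const, nonpos_iff_eq_zero]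
  exact (ProbabilityMeasure.null_iff_toMeasure_null ν unitSqᶜ).symm

lemma mem_Mcal_of_absolutelyContinuous {μ ν : ProbabilityMeasure Ω2} (hμ : μ ∈ Mcal)
    (h : (ν : Measure Ω2) ≪ μ) : ν ∈ Mcal :=
  ⟨(mem_Pcal_iff_compl ν).2 (h ((mem_Pcal_iff_compl μ).1 hμ.1)),
    fun x => (h.map measurable_fst) (hμ.2.1 x), fun y => (h.map measurable_snd) (hμ.2.2 y)⟩

lemma absolutelyContinuous_of_KL_ne_top {μ ν : Measure Ω2} (h : KL ν μ ≠ ∞) : ν ≪ μ := by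
  by_contra hac
  exact h (if_neg hac)

/-- Near a non-optimal measure, the Gibbs probability of the empirical measure vanishes. -/
lemma exists_nhds_tendsto_Qgibbs_of_notMem_Fset {k : ℕ} (σ : Equiv.Perm (Fin k))
    {μ : ProbabilityMeasure Ω2} (hμ : μ ∈ Mcal) (θ : ℝ) {ν : ProbabilityMeasure Ω2}
    (hν : ν ∉ Fset σ (μ : Measure Ω2) θ) :
    ∃ U ∈ 𝓝 ν, Tendsto (fun n => Qgibbs σ (μ : Measure Ω2) θ n (empIn n U)) atTop (𝓝 0) := by
  have hφ : ∀ (φ : BoundedContinuousFunction Ω2 ℝ) {δ : ℝ}, 0 < δ →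
      ∀ᶠ q : ProbabilityMeasure Ω2 in 𝓝 ν,
        ∫ x, φ x ∂(ν : Measure Ω2) - δ < ∫ x, φ x ∂(q : Measure Ω2) := fun φ δ hδ =>
    (ProbabilityMeasure.tendsto_iff_forall_integral_tendsto.1 tendsto_id φ).eventually_const_lt
      (by simpa using hδ)
  by_cases hK : KL (ν : Measure Ω2) μ = ∞
  · have hKμ : KL (μ : Measure Ω2) μ = 0 := by
      rw [KL_eq_klDiv, InformationTheory.klDiv_self]
    obtain ⟨φ, hφc⟩ := exists_boundedContinuous_dual (μ := (μ : Measure Ω2))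
      (ν := (ν : Measure Ω2)) (c := 2 * |θ| + 1) (Or.inr (by rw [hK]; exact ENNReal.ofReal_lt_top))
    have habs : ∀ q : ProbabilityMeasure Ω2, |θ * tPat σ (q : Measure Ω2)| ≤ |θ| := fun q => by
      obtain ⟨h0, h1⟩ := tPat_mem_Icc σ (q : Measure Ω2)
      rw [abs_mul, abs_of_nonneg h0]
      exact mul_le_of_le_one_right (abs_nonneg _) h1
    refine ⟨_, hφ φ one_pos, tendsto_Qgibbs_empIn σ hμ (ν := (μ : Measure Ω2)) (φ := φ)
      (a := |θ| + 1 - ∫ x, φ x ∂(ν : Measure Ω2)) (by simp [hKμ]) (fun q hq => ?_) ?_⟩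
    · have hq' : ∫ x, φ x ∂(ν : Measure Ω2) - 1 < ∫ x, φ x ∂(q : Measure Ω2) := hq
      linarith [(abs_le.1 (habs q)).2]
    · rw [hKμ, ENNReal.toReal_zero]
      linarith [(abs_le.1 (habs μ)).1]
  · have hνM : ν ∈ Mcal :=
      mem_Mcal_of_absolutelyContinuous hμ (absolutelyContinuous_of_KL_ne_top hK)
    have hcoe : ∀ q : ProbabilityMeasure Ω2, KL (q : Measure Ω2) μ ≠ ∞ →
        ((KL (q : Measure Ω2) μ : ℝ≥0∞) : EReal) = ((KL (q : Measure Ω2) μ).toReal : ℝ) :=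
      fun q hq => (EReal.coe_toReal (by simpa using hq) (by simp)).symm.trans (by simp)
    obtain ⟨ν', hν', hlt⟩ : ∃ ν' : ProbabilityMeasure Ω2, KL (ν' : Measure Ω2) μ ≠ ∞ ∧
        θ * tPat σ (ν : Measure Ω2) - (KL (ν : Measure Ω2) μ).toReal
          < θ * tPat σ (ν' : Measure Ω2) - (KL (ν' : Measure Ω2) μ).toReal := by
      have hlt : (((θ * tPat σ (ν : Measure Ω2) : ℝ) : EReal)
          - ((KL (ν : Measure Ω2) μ : ℝ≥0∞) : EReal)) < Fsup σ (μ : Measure Ω2) θ :=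
        lt_of_le_of_ne (le_iSup₂_of_le ν hνM le_rfl) fun h => hν ⟨hνM, h⟩
      simp only [Fsup, lt_iSup_iff] at hlt
      obtain ⟨ν', -, h⟩ := hlt
      have hν' : KL (ν' : Measure Ω2) μ ≠ ∞ := fun h' => by simp [h'] at h
      refine ⟨ν', hν', ?_⟩
      rw [hcoe ν hK, hcoe ν' hν'] at h
      exact_mod_cast h
    set γ := θ * tPat σ (ν' : Measure Ω2) - (KL (ν' : Measure Ω2) μ).toReal
      - (θ * tPat σ (ν : Measure Ω2) - (KL (ν : Measure Ω2) μ).toReal) with hγ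
    have hγ0 : 0 < γ / 3 := by linarith
    obtain ⟨φ, hφc⟩ := exists_boundedContinuous_dual (μ := (μ : Measure Ω2))
      (ν := (ν : Measure Ω2)) (c := (KL (ν : Measure Ω2) μ).toReal - γ / 3) (by
        rcases lt_or_ge ((KL (ν : Measure Ω2) μ).toReal - γ / 3) 0 with h | h
        · exact Or.inl h
        · exact Or.inr ((ENNReal.ofReal_lt_iff_lt_toReal h hK).2 (by linarith)))
    have ht := ((tendsto_tPat σ hνM).const_mul θ).eventually_lt_const
      (lt_add_of_pos_right _ hγ0)
    refine ⟨_, (hφ φ hγ0).and ht, tendsto_Qgibbs_empIn σ hμ (ν := (ν' : Measure Ω2)) (φ := φ)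
      (a := θ * tPat σ (ν : Measure Ω2) + γ / 3 - (∫ x, φ x ∂(ν : Measure Ω2) - γ / 3))
      hν' (fun q hq => ?_) (by linarith)⟩
    obtain ⟨hq1, hq2⟩ : ∫ x, φ x ∂(ν : Measure Ω2) - γ / 3 < ∫ x, φ x ∂(q : Measure Ω2) ∧
      θ * tPat σ (q : Measure Ω2) < θ * tPat σ (ν : Measure Ω2) + γ / 3 := hq
    linarith

lemma empM_compl_unitSq {n : ℕ} {z : Fin n → Ω2} (hz : ∀ i, z i ∈ unitSq) :
    empM z unitSqᶜ = 0 := by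
  simp [empM, measurableSet_unitSq.compl, hz]

lemma ae_forall_mem_unitSq {n : ℕ} {μ : ProbabilityMeasure Ω2} (hμ : μ ∈ Pcal) :
    ∀ᵐ z ∂pmeas (μ : Measure Ω2) n, ∀ i, z i ∈ unitSq :=
  ae_all_iff.2 fun i =>
    (measurePreserving_eval (fun _ : Fin n => (μ : Measure Ω2)) i).quasiMeasurePreserving.ae
      ((mem_Pcal_iff_compl μ).1 hμ)

lemma Qgibbs_eq_zero {k n : ℕ} (σ : Equiv.Perm (Fin k)) (μ : Measure Ω2) (θ : ℝ)
    {A : Set (Fin n → Ω2)} (hA : pmeas μ n A = 0) : Qgibbs σ μ θ n A = 0 :=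
  withDensity_absolutelyContinuous _ _ hA

lemma tendsto_Qgibbs_dist {k : ℕ} (σ : Equiv.Perm (Fin k)) {μ : ProbabilityMeasure Ω2}
    (hμ : μ ∈ Mcal) (θ : ℝ) {ε : ℝ} (hε : 0 < ε) :
    Tendsto (fun n : ℕ => Qgibbs σ (μ : Measure Ω2) θ n {z | ENNReal.ofReal ε ≤
      ⨅ ν ∈ Fset σ (μ : Measure Ω2) θ, dLPE (EmM (inducedPerm z)) (Omap ν)}) atTop (𝓝 0) := by
  set B : (n : ℕ) → Set (Fin n → Ω2) := fun n => {z | ENNReal.ofReal ε ≤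
    ⨅ ν ∈ Fset σ (μ : Measure Ω2) θ, dLPE (EmM (inducedPerm z)) (Omap ν)} with hB
  have hmono : ∀ {f g : ℕ → ℝ≥0∞}, (∀ n, n ≠ 0 → f n ≤ g n) → Tendsto g atTop (𝓝 0) →
      Tendsto f atTop (𝓝 0) := fun h hg =>
    tendsto_of_tendsto_of_tendsto_of_le_of_le' tendsto_const_nhds hg
      (Eventually.of_forall fun _ => zero_le) ((eventually_ne_atTop 0).mono h)
  have key : Tendsto (fun n => Qgibbs σ (μ : Measure Ω2) θ n (B n ∩ empIn n Pcal)) atTop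
      (𝓝 0) := by
    refine isCompact_Pcal.induction_on
      (p := fun S => Tendsto (fun n => Qgibbs σ (μ : Measure Ω2) θ n (B n ∩ empIn n S)) atTop (𝓝 0))
      ?_ ?_ ?_ ?_
    · simp [empIn]
    · intro S T hST hT
      refine hmono (fun n _ => measure_mono (Set.inter_subset_inter_right _ ?_)) hT
      rintro z ⟨q, hq, hz⟩
      exact ⟨q, hST hq, hz⟩
    · intro S T hS hT
      refine hmono (fun n _ => ?_) (by simpa using hS.add hT)
      refine (measure_mono ?_).trans (measure_union_le _ _)
      rintro z ⟨hzB, q, hq | hq, hz⟩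
      exacts [Or.inl ⟨hzB, q, hq, hz⟩, Or.inr ⟨hzB, q, hq, hz⟩]
    · intro ν _
      by_cases hν : ν ∈ Fset σ (μ : Measure Ω2) θ
      · refine ⟨_, mem_nhdsWithin_of_mem_nhds (eventually_dLPE_Omap_lt hν.1 hε), ?_⟩
        refine hmono (g := fun _ => 0) (fun n hn => (Qgibbs_eq_zero σ _ θ ?_).le)
          tendsto_const_nhds
        have : NeZero n := ⟨hn⟩
        refine measure_mono_null ?_ (ae_isGeneric (n := n) hμ)
        rintro z ⟨hzB, q, hq, hqz⟩ hz
        have hq' : dLPE (Omap (q : Measure Ω2)) (Omap (ν : Measure Ω2)) < ENNReal.ofReal ε := hq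
        rw [hqz, ← EmM_inducedPerm hz] at hq'
        exact (hq'.trans_le hzB).not_ge (iInf₂_le ν hν)
      · obtain ⟨U, hU, hlim⟩ := exists_nhds_tendsto_Qgibbs_of_notMem_Fset σ hμ θ hν
        exact ⟨U, mem_nhdsWithin_of_mem_nhds hU,
          hmono (fun n _ => measure_mono Set.inter_subset_right) hlim⟩
  refine hmono (fun n hn => ?_) key
  have : NeZero n := ⟨hn⟩
  have hsub : B n ⊆ (B n ∩ empIn n Pcal) ∪ {z | ¬ ∀ i, z i ∈ unitSq} := by
    intro z hz
    by_cases h : ∀ i, z i ∈ unitSq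
    · exact Or.inl ⟨hz, ⟨empM z, inferInstance⟩,
        (mem_Pcal_iff_compl _).2 (empM_compl_unitSq h), rfl⟩
    · exact Or.inr h
  refine (measure_mono hsub).trans ((measure_union_le _ _).trans ?_)
  have h0 : Qgibbs σ (μ : Measure Ω2) θ n {z | ¬ ∀ i, z i ∈ unitSq} = 0 :=
    Qgibbs_eq_zero σ _ θ (ae_forall_mem_unitSq hμ.1)
  rw [h0, add_zero]

lemma Qgibbs_univ {k n : ℕ} [NeZero n] (σ : Equiv.Perm (Fin k)) {μ : ProbabilityMeasure Ω2}
    (hμ : μ ∈ Mcal) (θ : ℝ) : Qgibbs σ (μ : Measure Ω2) θ n Set.univ = 1 := by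
  rw [Qgibbs_apply σ hμ]
  refine ENNReal.div_self (fun h => ?_) (gibbsWeight_univ_ne_top σ _ θ)
  have hKμ : KL (μ : Measure Ω2) μ ≠ ∞ := by simp [KL_eq_klDiv, InformationTheory.klDiv_self]
  have hle := le_gibbsWeight_univ (n := n) σ θ hKμ
  rw [h, nonpos_iff_eq_zero, ENNReal.ofReal_eq_zero] at hle
  exact hle.not_gt (Real.exp_pos _)

lemma Fset_nonempty {k : ℕ} (σ : Equiv.Perm (Fin k)) {μ : ProbabilityMeasure Ω2}
    (hμ : μ ∈ Mcal) (θ : ℝ) : (Fset σ (μ : Measure Ω2) θ).Nonempty := by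
  by_contra h
  have hlim := tendsto_Qgibbs_dist σ hμ θ one_pos
  rw [Set.not_nonempty_iff_eq_empty.1 h] at hlim
  have hone : Tendsto (fun _ : ℕ => (1 : ℝ≥0∞)) atTop (𝓝 0) := by
    refine hlim.congr' ?_
    filter_upwards [eventually_ne_atTop 0] with n hn
    have : NeZero n := ⟨hn⟩
    rw [← Qgibbs_univ (n := n) σ hμ θ]
    congr 1
    ext z
    simp
  exact one_ne_zero (tendsto_nhds_unique tendsto_const_nhds hone)

/-- Theorem 1.9 (iv): `ℱ(σ,μ,θ)` is nonempty and the Lévy–Prokhorov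
distance from `Em(π_{n,σ,μ,θ})` to `𝒪(ℱ(σ,μ,θ))` tends to `0` in probability. -/
theorem gibbs_converges_to_optimizers {k : ℕ} (σ : Equiv.Perm (Fin k))
    (μ : ProbabilityMeasure Ω2) (hμ : μ ∈ Mcal) (θ : ℝ) :
    (Fset σ (↑μ) θ).Nonempty ∧
    ∀ ε > (0 : ℝ),
      Tendsto (fun n : ℕ =>
          Qgibbs σ (↑μ) θ n {z | ENNReal.ofReal ε ≤
            ⨅ ν ∈ Fset σ ((↑μ : Measure Ω2)) θ, dLPE (EmM (inducedPerm z)) (Omap ↑ν)})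
        atTop (𝓝 0) :=
  ⟨Fset_nonempty σ hμ θ, fun _ hε => tendsto_Qgibbs_dist σ hμ θ hε⟩

end
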